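/- Let f₁,…,f_m ∈ L²(ℝⁿ) and ℓ ∈ ℕ. Then there exist φ₁,…,φ_ℓ ∈ L²(ℝⁿ) such that, with V_θ the L²-closure of the linear span of {T_k^θ φ_i : k ∈ ℤⁿ, 1 ≤ i ≤ ℓ}: (a) Σ_{i=1}^m ‖f_i − P_{V_θ} f_i‖² ≤ Σ_{i=1}^m ‖f_i − P_{W} f_i‖² for every θ-shift invariant space W generated by at most ℓ elements of L²(ℝⁿ); (b) the system {T_k^θ φ_i : k ∈ ℤⁿ, 1 ≤ i ≤ ℓ} is a Parseval frame for V_θ; and (c) Σ_{i=1}^m ‖f_i − P_{V_θ} f_i‖² = Σ_{i=ℓ+1}^m ∫_I λ_i(ω) dω, where for a.e. ω ∈ I, λ₁(ω) ≥ ⋯ ≥ λ_m(ω) ≥ 0 are the decreasingly ordered eigenvalues of the Hermitian positive semidefinite Gramian matrix G^θ(ω) with entries [G^θ(ω)]_{ij} = ⟨τ^θ f_i(ω), τ^θ f_j(ω)⟩_{ℓ²(ℤⁿ)}, and ω ↦ λ_i(ω) are measurable. -/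

import Mathlib

noncomputable section

open MeasureTheory Complex
open scoped InnerProductSpace ENNReal

abbrev Rn (n : ℕ) : Type := EuclideanSpace ℝ (Fin n)

variable {n : ℕ}

/-- θ-translation: `T_s^θ f (t) = e^{-2πi (s·(t-s)) cot θ} f (t-s)`. -/
def thetaTrans (θ : ℝ) (s : Rn n) (f : Rn n → ℂ) : Rn n → ℂ :=
  fun t => Complex.exp (((-2 * Real.pi * ⟪s, t - s⟫_ℝ * Real.cot θ : ℝ) : ℂ) * Complex.I) * f (t - s)

/-- Chirp modulation `C_θ f (t) = e^{πi (t·t) cot θ} f(t)`. -/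
def chirp (θ : ℝ) (f : Rn n → ℂ) : Rn n → ℂ :=
  fun t => Complex.exp (((Real.pi * ⟪t, t⟫_ℝ * Real.cot θ : ℝ) : ℂ) * Complex.I) * f t

lemma memℒp_chirp (θ : ℝ) (f : Rn n → ℂ) (hf : MemLp f 2 (volume : Measure (Rn n))) :
    MemLp (chirp θ f) 2 (volume : Measure (Rn n)) := by
  have hcont : Continuous fun t : Rn n =>
      Complex.exp (((Real.pi * ⟪t, t⟫_ℝ * Real.cot θ : ℝ) : ℂ) * Complex.I) :=
    Complex.continuous_exp.comp
      ((Complex.continuous_ofReal.comp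
        ((continuous_const.mul ((continuous_id (X := Rn n)).inner continuous_id)).mul
          continuous_const)).mul continuous_const)
  refine ⟨hcont.aestronglyMeasurable.mul hf.1, ?_⟩
  have heq : eLpNorm (chirp θ f) 2 (volume : Measure (Rn n)) = eLpNorm f 2 volume := by
    refine eLpNorm_congr_norm_ae (Filter.Eventually.of_forall fun t => ?_)
    show ‖Complex.exp (((Real.pi * ⟪t, t⟫_ℝ * Real.cot θ : ℝ) : ℂ) * Complex.I) * f t‖ = ‖f t‖
    rw [norm_mul, Complex.norm_exp_ofReal_mul_I, one_mul]
  exact heq ▸ hf.2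

lemma memℒp_thetaTrans (θ : ℝ) (s : Rn n) (f : Rn n → ℂ)
    (hf : MemLp f 2 (volume : Measure (Rn n))) :
    MemLp (thetaTrans θ s f) 2 (volume : Measure (Rn n)) := by
  have htr : MemLp (fun t : Rn n => f (t - s)) 2 (volume : Measure (Rn n)) :=
    hf.comp_measurePreserving (measurePreserving_sub_right volume s)
  have hcont : Continuous fun t : Rn n =>
      Complex.exp (((-2 * Real.pi * ⟪s, t - s⟫_ℝ * Real.cot θ : ℝ) : ℂ) * Complex.I) :=
    Complex.continuous_exp.comp
      ((Complex.continuous_ofReal.comp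
        ((continuous_const.mul
          (continuous_const.inner ((continuous_id (X := Rn n)).sub continuous_const))).mul
          continuous_const)).mul continuous_const)
  refine ⟨hcont.aestronglyMeasurable.mul htr.1, ?_⟩
  have heq : eLpNorm (thetaTrans θ s f) 2 (volume : Measure (Rn n)) =
      eLpNorm (fun t : Rn n => f (t - s)) 2 volume := by
    refine eLpNorm_congr_norm_ae (Filter.Eventually.of_forall fun t => ?_)
    show ‖Complex.exp (((-2 * Real.pi * ⟪s, t - s⟫_ℝ * Real.cot θ : ℝ) : ℂ) * Complex.I) *
        f (t - s)‖ = ‖f (t - s)‖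
    rw [norm_mul, Complex.norm_exp_ofReal_mul_I, one_mul]
  exact heq ▸ htr.2

/-- Chirp modulation as a map on `L²(ℝⁿ)`. -/
def chirpLp (θ : ℝ) (f : Lp ℂ 2 (volume : Measure (Rn n))) :
    Lp ℂ 2 (volume : Measure (Rn n)) :=
  (memℒp_chirp θ f (Lp.memLp f)).toLp (chirp θ f)

/-- θ-translation as a map on `L²(ℝⁿ)`. -/
def thetaTransLp (θ : ℝ) (s : Rn n) (f : Lp ℂ 2 (volume : Measure (Rn n))) :
    Lp ℂ 2 (volume : Measure (Rn n)) :=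
  (memℒp_thetaTrans θ s f (Lp.memLp f)).toLp (thetaTrans θ s f)

/-- `𝓕` is the Fourier–Plancherel transform. -/
def IsPlancherel
    (𝓕 : Lp ℂ 2 (volume : Measure (Rn n)) ≃ₗᵢ[ℂ] Lp ℂ 2 (volume : Measure (Rn n))) : Prop :=
  ∀ (f : Rn n → ℂ) (hf : MemLp f 2 (volume : Measure (Rn n))),
    Integrable f (volume : Measure (Rn n)) →
      (𝓕 (hf.toLp f) : Rn n → ℂ) =ᵐ[(volume : Measure (Rn n))]
        fun ξ => ∫ t, f t * Complex.exp (((-2 * Real.pi * ⟪t, ξ⟫_ℝ : ℝ) : ℂ) * Complex.I)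

/-- The embedding `ℤⁿ ↪ ℝⁿ`. -/
def zcast {n : ℕ} (k : Fin n → ℤ) : Rn n :=
  (WithLp.equiv 2 (Fin n → ℝ)).symm fun i => (k i : ℝ)

/-- The box `I = [0, |sin θ|]ⁿ`. -/
def Iθ (n : ℕ) (θ : ℝ) : Set (Rn n) := {ω | ∀ i, ω i ∈ Set.Icc (0 : ℝ) |Real.sin θ|}

/-- The fiber `τ^θ f (ω) = |sin θ|^{-n/2} ((C_θ f)^(ω csc θ + k))_{k ∈ ℤⁿ}`. -/
def fiber (𝓕 : Lp ℂ 2 (volume : Measure (Rn n)) ≃ₗᵢ[ℂ] Lp ℂ 2 (volume : Measure (Rn n)))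
    (θ : ℝ) (f : Lp ℂ 2 (volume : Measure (Rn n))) (ω : Rn n) (k : Fin n → ℤ) : ℂ :=
  ((|Real.sin θ| ^ (-(n : ℝ) / 2) : ℝ) : ℂ) *
    (𝓕 (chirpLp θ f) : Rn n → ℂ) ((Real.sin θ)⁻¹ • ω + zcast k)

/-- The fiber space `J_V^θ(ω)`: the closure in `ℓ²(ℤⁿ)` of `{τ^θ f (ω) : f ∈ V}`. -/
def Jfib (𝓕 : Lp ℂ 2 (volume : Measure (Rn n)) ≃ₗᵢ[ℂ] Lp ℂ 2 (volume : Measure (Rn n)))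
    (θ : ℝ) (V : Submodule ℂ (Lp ℂ 2 (volume : Measure (Rn n)))) (ω : Rn n) :
    Set (lp (fun _ : Fin n → ℤ => ℂ) 2) :=
  closure {x : lp (fun _ : Fin n → ℤ => ℂ) 2 | ∃ f ∈ V, ∀ j, x j = fiber 𝓕 θ f ω j}

/-- A nonnegative Carathéodory function on a compact metric space, each of whose sections
has a zero, admits a measurable selection of zeros. -/
theorem exists_measurable_zero_selection {X K : Type*} [MeasurableSpace X] [MetricSpace K]
    [CompactSpace K] [Nonempty K] [MeasurableSpace K] [BorelSpace K] (g : X → K → ℝ)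
    (hm : ∀ k, Measurable fun x => g x k) (hc : ∀ x, Continuous (g x)) (h0 : ∀ x k, 0 ≤ g x k)
    (hz : ∀ x, ∃ k, g x k = 0) : ∃ s : X → K, Measurable s ∧ ∀ x, g x (s x) = 0 := by
  obtain ⟨p, hp, hps⟩ := exists_nat_bool_continuous_surjective_of_compact K
  set q : cantorSet → K := p ∘ cantorSetHomeomorphNatToBool with hq
  have hqc : Continuous q := hp.comp cantorSetHomeomorphNatToBool.continuous
  have hqs : Function.Surjective q := hps.comp cantorSetHomeomorphNatToBool.surjective
  have hcomp : CompactSpace cantorSet := isCompact_iff_compactSpace.mp isCompact_cantorSet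
  set S : X → Set ℝ := fun x => Subtype.val '' {t : cantorSet | g x (q t) = 0} with hS
  have hScompact : ∀ x, IsCompact (S x) := fun x =>
    ((isClosed_eq ((hc x).comp hqc) continuous_const).isCompact).image continuous_subtype_val
  have hSne : ∀ x, (S x).Nonempty := fun x => by
    obtain ⟨k, hk⟩ := hz x
    obtain ⟨t, rfl⟩ := hqs k
    exact ⟨t, t, hk, rfl⟩
  have hmem : ∀ x, sInf (S x) ∈ S x := fun x => (hScompact x).sInf_mem (hSne x)
  have hmeas : Measurable fun x => sInf (S x) := by
    refine measurable_of_Iic fun a => ?_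
    set A : Set cantorSet := {t | (t : ℝ) ≤ a} with hA
    have hAc : CompactSpace A := isCompact_iff_compactSpace.mp
      (isClosed_le continuous_subtype_val continuous_const).isCompact
    have hiff : ∀ x, sInf (S x) ≤ a ↔ ∃ t : A, g x (q t) = 0 := fun x => by
      constructor
      · intro h
        obtain ⟨t, ht, hta⟩ := hmem x
        exact ⟨⟨t, by rw [hA, Set.mem_ofPred_eq, hta]; exact h⟩, ht⟩
      · rintro ⟨⟨t, hta⟩, ht⟩
        exact (csInf_le (hScompact x).bddBelow ⟨t, ht, rfl⟩).trans hta
    rcases isEmpty_or_nonempty A with hAe | hAn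
    · convert MeasurableSet.empty using 1
      ext x
      simp [hiff x]
    · have hset : (fun x => sInf (S x)) ⁻¹' Set.Iic a =
          ⋂ N : ℕ, ⋃ d : ℕ, {x | g x (q (TopologicalSpace.denseSeq A d)) < 1 / ((N : ℝ) + 1)} := by
        ext x
        have hgc : Continuous fun t : A => g x (q t) :=
          (hc x).comp (hqc.comp continuous_subtype_val)
        simp only [Set.mem_preimage, Set.mem_Iic, hiff x, Set.mem_iInter, Set.mem_iUnion,
          Set.mem_ofPred_eq]
        constructor
        · rintro ⟨t, ht⟩ N
          obtain ⟨y, hy, d, rfl⟩ := (TopologicalSpace.denseRange_denseSeq A).inter_open_nonempty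
            {t | g x (q t) < 1 / ((N : ℝ) + 1)} (isOpen_lt hgc continuous_const)
            ⟨t, by rw [Set.mem_ofPred_eq, ht]; positivity⟩
          exact ⟨d, hy⟩
        · intro h
          obtain ⟨t, -, ht⟩ := isCompact_univ.exists_isMinOn Set.univ_nonempty hgc.continuousOn
          refine ⟨t, le_antisymm (le_of_forall_pos_lt_add fun ε hε => ?_) (h0 _ _)⟩
          obtain ⟨N, hN⟩ := exists_nat_one_div_lt hε
          obtain ⟨d, hd⟩ := h N
          have := isMinOn_iff.mp ht (TopologicalSpace.denseSeq A d) (Set.mem_univ _)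
          linarith
      rw [hset]
      exact MeasurableSet.iInter fun N => MeasurableSet.iUnion fun d =>
        measurableSet_lt (hm _) measurable_const
  have hcantor : ∀ x, sInf (S x) ∈ cantorSet := fun x => by
    obtain ⟨t, -, ht⟩ := hmem x
    exact ht ▸ t.2
  refine ⟨fun x => q ⟨sInf (S x), hcantor x⟩, hqc.measurable.comp (hmeas.subtype_mk), fun x => ?_⟩
  obtain ⟨t, ht, hta⟩ := hmem x
  have : (⟨sInf (S x), hcantor x⟩ : cantorSet) = t := Subtype.ext hta.symm
  change g x (q ⟨sInf (S x), hcantor x⟩) = 0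
  rw [this]
  exact ht

/-- Every Hermitian matrix is unitarily diagonalizable with decreasingly ordered eigenvalues. -/
theorem Matrix.IsHermitian.exists_unitary_antitone {m : ℕ} {G : Matrix (Fin m) (Fin m) ℂ}
    (hG : G.IsHermitian) : ∃ U ∈ Matrix.unitaryGroup (Fin m) ℂ, ∃ μ : Fin m → ℝ, Antitone μ ∧
      star U * G * U = Matrix.diagonal fun i => (μ i : ℂ) := by
  set V : Matrix (Fin m) (Fin m) ℂ := hG.eigenvectorUnitary.1 with hV
  have hVu : V ∈ Matrix.unitaryGroup (Fin m) ℂ := hG.eigenvectorUnitary.2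
  have hd : star V * G * V = Matrix.diagonal fun i => (hG.eigenvalues i : ℂ) := by
    have h := hG.spectral_theorem
    rw [Unitary.conjStarAlgAut_apply, ← hV] at h
    conv_lhs => rw [h]
    have h1 : star V * V = 1 := Matrix.mem_unitaryGroup_iff'.mp hVu
    calc _ = (star V * V) * Matrix.diagonal (RCLike.ofReal ∘ hG.eigenvalues) * (star V * V) := by
          simp only [Matrix.mul_assoc, hV]
      _ = _ := by rw [h1]; simp
  set σ := Tuple.sort fun i => -hG.eigenvalues i
  have hσ : Antitone fun i => hG.eigenvalues (σ i) := fun i j hij =>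
    neg_le_neg_iff.mp (Tuple.monotone_sort (fun i => -hG.eigenvalues i) hij)
  have hstar : star (V.submatrix id σ) = (star V).submatrix σ id := rfl
  refine ⟨V.submatrix id σ, ?_, fun i => hG.eigenvalues (σ i), hσ, ?_⟩
  · rw [Matrix.mem_unitaryGroup_iff', hstar]
    have := Matrix.submatrix_mul (star V) V σ id σ Function.bijective_id
    rw [← this, Matrix.mem_unitaryGroup_iff'.mp hVu]
    simp
  · rw [hstar]
    have h1 : (star V).submatrix σ id * G = (star V * G).submatrix σ id := by
      rw [Matrix.submatrix_mul _ _ σ id id Function.bijective_id, Matrix.submatrix_id_id]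
    rw [h1, ← Matrix.submatrix_mul _ _ σ id σ Function.bijective_id, hd]
    exact Matrix.submatrix_diagonal _ _ σ.injective

/-- A measurable field of Hermitian matrices has a measurable unitary diagonalization with
decreasingly ordered eigenvalues. -/
theorem exists_measurable_unitary_diagonalization {X : Type*} [MeasurableSpace X] {m : ℕ}
    (G : X → Matrix (Fin m) (Fin m) ℂ) (hG : ∀ i j, Measurable fun x => G x i j)
    (hH : ∀ x, (G x).IsHermitian) :
    ∃ (U : X → Matrix (Fin m) (Fin m) ℂ) (μ : Fin m → X → ℝ),
      (∀ i j, Measurable fun x => U x i j) ∧ (∀ i, Measurable (μ i)) ∧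
      ∀ x, U x ∈ Matrix.unitaryGroup (Fin m) ℂ ∧ (Antitone fun i => μ i x) ∧
        star (U x) * G x * U x = Matrix.diagonal fun i => (μ i x : ℂ) := by
  set K : Set (Fin m → Fin m → ℂ) := {V | Matrix.of V ∈ Matrix.unitaryGroup (Fin m) ℂ} with hK
  have hKclosed : IsClosed K := by
    have : K = {V | star (Matrix.of V) * Matrix.of V = 1} := by
      ext V; exact Matrix.mem_unitaryGroup_iff'
    rw [this]
    refine isClosed_eq ?_ continuous_const
    exact (Continuous.matrix_conjTranspose continuous_id).matrix_mul continuous_id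
  have hKb : K ⊆ Metric.closedBall 0 1 := fun V hV => by
    rw [mem_closedBall_zero_iff, pi_norm_le_iff_of_nonneg zero_le_one]
    intro i
    rw [pi_norm_le_iff_of_nonneg zero_le_one]
    exact fun j => entry_norm_bound_of_unitary hV i j
  have hKc : CompactSpace K := isCompact_iff_compactSpace.mp
    ((isCompact_closedBall _ _).of_isClosed_subset hKclosed hKb)
  have hKne : Nonempty K := ⟨⟨(1 : Matrix (Fin m) (Fin m) ℂ), one_mem (Matrix.unitaryGroup _ _)⟩⟩
  set D : X → K → Matrix (Fin m) (Fin m) ℂ := fun x V =>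
    star (Matrix.of V.1) * G x * Matrix.of V.1 with hD
  have hDapply : ∀ x V i j, D x V i j =
      ∑ l, (∑ k, (starRingEnd ℂ) (V.1 k i) * G x k l) * V.1 l j := fun x V i j => by
    simp only [hD, Matrix.mul_apply, Matrix.star_apply, Matrix.of_apply]; rfl
  have hDc : ∀ x i j, Continuous fun V => D x V i j := fun x i j => by
    simp only [hDapply]
    have hV : ∀ a b, Continuous fun V : K => V.1 a b := fun a b =>
      (continuous_apply b).comp ((continuous_apply a).comp continuous_subtype_val)
    exact continuous_finsetSum _ fun l _ => (continuous_finsetSum _ fun k _ =>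
      (Complex.continuous_conj.comp (hV k i)).mul continuous_const).mul (hV l j)
  have hDm : ∀ (V : X → K), (∀ i j, Measurable fun x => (V x).1 i j) → ∀ i j,
      Measurable fun x => D x (V x) i j := fun V hV i j => by
    simp only [hDapply]
    refine Finset.measurable_sum _ fun l _ => Measurable.mul ?_ (hV _ _)
    exact Finset.measurable_sum _ fun k _ =>
      (Complex.continuous_conj.measurable.comp (hV _ _)).mul (hG _ _)
  set g : X → K → ℝ := fun x V =>
    ∑ i, ∑ j, ((if i = j then |(D x V i i).im| else ‖D x V i j‖) +
      if i ≤ j then max 0 ((D x V j j).re - (D x V i i).re) else 0) with hg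
  have hterm0 : ∀ x V i j, 0 ≤ (if i = j then |(D x V i i).im| else ‖D x V i j‖) +
      if i ≤ j then max 0 ((D x V j j).re - (D x V i i).re) else 0 := fun x V i j => by
    split_ifs <;> positivity
  have hzero : ∀ x V, g x V = 0 ↔ (D x V = Matrix.diagonal fun i => ((D x V i i).re : ℂ)) ∧
      Antitone fun i => (D x V i i).re := fun x V => by
    simp only [hg]
    rw [Finset.sum_eq_zero_iff_of_nonneg fun i _ => Finset.sum_nonneg fun j _ => hterm0 x V i j]
    simp only [Finset.sum_eq_zero_iff_of_nonneg fun j _ => hterm0 x V _ j, Finset.mem_univ,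
      true_implies]
    constructor
    · intro h
      constructor
      · ext i j
        have hij := h i j
        by_cases hc : i = j
        · subst hc
          simp only [if_true, le_refl, sub_self, max_self, add_zero, abs_eq_zero] at hij
          rw [Matrix.diagonal_apply_eq]
          exact Complex.ext (by simp) (by simpa using hij)
        · rw [Matrix.diagonal_apply_ne _ hc]
          rw [if_neg hc] at hij
          have h2 : 0 ≤ if i ≤ j then max 0 ((D x V j j).re - (D x V i i).re) else 0 := by
            split_ifs <;> positivity
          exact norm_le_zero_iff.mp (by linarith)
      · intro i j hle
        have hij := h i j
        rw [if_pos hle] at hij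
        have h2 : 0 ≤ if i = j then |(D x V i i).im| else ‖D x V i j‖ := by
          split_ifs <;> positivity
        have := le_max_right 0 ((D x V j j).re - (D x V i i).re)
        change (D x V j j).re ≤ (D x V i i).re
        linarith
    · rintro ⟨h1, h2⟩ i j
      have ha : (if i = j then |(D x V i i).im| else ‖D x V i j‖) = 0 := by
        split_ifs with hc
        · rw [h1, Matrix.diagonal_apply_eq]; simp
        · rw [h1, Matrix.diagonal_apply_ne _ hc]; simp
      have hb : (if i ≤ j then max 0 ((D x V j j).re - (D x V i i).re) else 0) = 0 := by
        split_ifs with hc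
        · exact max_eq_left (sub_nonpos.mpr (h2 hc))
        · rfl
      rw [ha, hb, add_zero]
  obtain ⟨s, hs, hs0⟩ := exists_measurable_zero_selection g
    (fun V => by
      have hDV := hDm (fun _ => V) fun _ _ => measurable_const
      refine Finset.measurable_sum _ fun i _ => Finset.measurable_sum _ fun j _ => Measurable.add ?_ ?_
      · split_ifs
        · exact (Complex.measurable_im.comp (hDV i i)).abs
        · exact (hDV i j).norm
      · split_ifs
        · exact measurable_const.max
            ((Complex.measurable_re.comp (hDV j j)).sub (Complex.measurable_re.comp (hDV i i)))
        · exact measurable_const)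
    (fun x => by
      refine continuous_finsetSum _ fun i _ => continuous_finsetSum _ fun j _ => Continuous.add ?_ ?_
      · split_ifs
        · exact (Complex.continuous_im.comp (hDc x i i)).abs
        · exact (hDc x i j).norm
      · split_ifs
        · exact continuous_const.max
            ((Complex.continuous_re.comp (hDc x j j)).sub (Complex.continuous_re.comp (hDc x i i)))
        · exact continuous_const)
    (fun x V => Finset.sum_nonneg fun i _ => Finset.sum_nonneg fun j _ => hterm0 x V i j)
    (fun x => by
      obtain ⟨U, hU, μ, hμ, h⟩ := (hH x).exists_unitary_antitone
      refine ⟨⟨U, hU⟩, (hzero _ _).mpr ?_⟩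
      have hDU : D x ⟨U, hU⟩ = Matrix.diagonal fun i => (μ i : ℂ) := h
      rw [hDU]
      simpa using hμ)
  have hsm : ∀ i j, Measurable fun x => (s x).1 i j := fun i j =>
    (measurable_pi_apply j).comp ((measurable_pi_apply i).comp (measurable_subtype_coe.comp hs))
  refine ⟨fun x => Matrix.of (s x).1, fun i x => (D x (s x) i i).re, hsm,
    fun i => Complex.measurable_re.comp (hDm s hsm i i), fun x => ⟨(s x).2, ?_, ?_⟩⟩
  · exact ((hzero _ _).mp (hs0 x)).2
  · exact ((hzero _ _).mp (hs0 x)).1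

section UnitaryMix

variable {E : Type*} [NormedAddCommGroup E] [InnerProductSpace ℂ E] {m : ℕ}

/-- The family `∑ j, conj (U j i) • x j`. -/
def unitaryMix {V : Type*} [AddCommMonoid V] [Module ℂ V] (U : Matrix (Fin m) (Fin m) ℂ)
    (x : Fin m → V) (i : Fin m) : V :=
  ∑ j, (starRingEnd ℂ) (U j i) • x j

theorem inner_unitaryMix (U : Matrix (Fin m) (Fin m) ℂ) (x : Fin m → E) (i j : Fin m) :
    ⟪unitaryMix U x j, unitaryMix U x i⟫_ℂ =
      (star U * Matrix.of (fun k l => ⟪x l, x k⟫_ℂ) * U) i j := by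
  simp only [unitaryMix, inner_sum, sum_inner, inner_smul_left, inner_smul_right,
    Matrix.mul_apply, Matrix.star_apply, Matrix.of_apply, Finset.sum_mul, Finset.mul_sum,
    Complex.conj_conj]
  rw [Finset.sum_comm]
  refine Finset.sum_congr rfl fun k _ => Finset.sum_congr rfl fun l _ => ?_
  simp only [RCLike.star_def]
  ring

theorem sum_norm_sq_unitaryMix {U : Matrix (Fin m) (Fin m) ℂ}
    (hU : U ∈ Matrix.unitaryGroup (Fin m) ℂ) (x : Fin m → E) :
    ∑ i, ‖unitaryMix U x i‖ ^ 2 = ∑ i, ‖x i‖ ^ 2 := by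
  have h : ∑ i, ⟪unitaryMix U x i, unitaryMix U x i⟫_ℂ = ∑ i, ⟪x i, x i⟫_ℂ := by
    simp only [inner_unitaryMix]
    change Matrix.trace _ = _
    rw [Matrix.trace_mul_cycle, Matrix.mem_unitaryGroup_iff.mp hU, one_mul]
    rfl
  simp only [inner_self_eq_norm_sq_to_K] at h
  exact_mod_cast h

end UnitaryMix

section OrthogonalFamilies

variable {E : Type*} [NormedAddCommGroup E] [InnerProductSpace ℂ E]

/-- Bessel's inequality for a finite family whose nonzero members are orthonormal. -/
theorem sum_norm_inner_sq_le_of_orthonormal_or_zero {ι : Type*} [Fintype ι] {v : ι → E}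
    (hv : ∀ i, v i = 0 ∨ ‖v i‖ = 1) (ho : ∀ i j, i ≠ j → ⟪v i, v j⟫_ℂ = 0) (x : E) :
    ∑ i, ‖⟪v i, x⟫_ℂ‖ ^ 2 ≤ ‖x‖ ^ 2 := by
  classical
  have hon : Orthonormal ℂ fun i : {i // v i ≠ 0} => v i :=
    ⟨fun i => (hv i).resolve_left i.2, fun i j hij => ho _ _ fun h => hij (Subtype.ext h)⟩
  have h := hon.sum_inner_products_le x (s := Finset.univ)
  refine le_trans (le_of_eq ?_) h
  rw [← Finset.sum_filter_of_ne (p := fun i => v i ≠ 0) fun i _ hi h0 => by simp [h0] at hi]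
  exact Finset.sum_subtype _ (by simp) _

/-- Normalization of a vector, with `0 ↦ 0`. -/
def unitize (x : E) : E := ((‖x‖⁻¹ : ℝ) : ℂ) • x

theorem unitize_eq_zero_or (x : E) : unitize x = 0 ∨ ‖unitize x‖ = 1 := by
  rcases eq_or_ne x 0 with rfl | hx
  · left; simp [unitize]
  · right
    rw [unitize, norm_smul, Complex.norm_real, norm_inv, norm_norm,
      inv_mul_cancel₀ (norm_ne_zero_iff.mpr hx)]

theorem norm_unitize_le (x : E) : ‖unitize x‖ ≤ 1 := by
  rcases unitize_eq_zero_or x with h | h <;> simp [h]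

theorem norm_smul_unitize (x : E) : ((‖x‖ : ℝ) : ℂ) • unitize x = x := by
  rcases eq_or_ne x 0 with rfl | hx
  · simp
  · rw [unitize, smul_smul, ← Complex.ofReal_mul, mul_inv_cancel₀ (norm_ne_zero_iff.mpr hx)]
    simp

theorem inner_unitize_eq_zero {x y : E} (h : ⟪x, y⟫_ℂ = 0) : ⟪unitize x, unitize y⟫_ℂ = 0 := by
  simp [unitize, h]

theorem norm_inner_unitize_self_sq (x : E) : ‖⟪unitize x, x⟫_ℂ‖ ^ 2 = ‖x‖ ^ 2 := by
  rcases eq_or_ne x 0 with rfl | hx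
  · simp
  · rw [unitize, inner_smul_left, inner_self_eq_norm_sq_to_K]
    have := norm_ne_zero_iff.mpr hx
    simp only [norm_mul, RCLike.norm_conj, Complex.norm_real, norm_inv, norm_norm, norm_pow,
      Complex.coe_algebraMap]
    field_simp

/-- For decreasing nonnegative weights `μ` and `0 ≤ c ≤ 1` of total mass at most `ℓ`, the weighted
defect dominates the tail of `μ`. -/
theorem sum_tail_le_sum_mul_one_sub {m ℓ : ℕ} {μ c : Fin m → ℝ} (hμ : Antitone μ)
    (hμ0 : ∀ i, 0 ≤ μ i) (hc0 : ∀ i, 0 ≤ c i) (hc1 : ∀ i, c i ≤ 1) (hc : ∑ i, c i ≤ ℓ) :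
    ∑ i ∈ Finset.univ.filter (fun i : Fin m => ℓ ≤ (i : ℕ)), μ i ≤ ∑ i, μ i * (1 - c i) := by
  rw [Finset.sum_filter]
  rcases le_or_gt m ℓ with h | h
  · rw [Finset.sum_eq_zero fun i _ => if_neg (by have := i.2; omega)]
    exact Finset.sum_nonneg fun i _ => mul_nonneg (hμ0 i) (by linarith [hc1 i])
  · set t := μ ⟨ℓ, h⟩ with ht
    have hcard : ∑ i : Fin m, (if (i : ℕ) < ℓ then (1 : ℝ) else 0) = ℓ := by
      rw [Fin.sum_univ_eq_sum_range (fun i => if i < ℓ then (1 : ℝ) else 0) m,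
        ← Finset.sum_filter]
      have : (Finset.range m).filter (· < ℓ) = Finset.range ℓ := by
        ext i; simp; omega
      simp [this]
    have hterm : ∀ i : Fin m, t * ((if (i : ℕ) < ℓ then (1 : ℝ) else 0) - c i) ≤
        μ i * (1 - c i) - if ℓ ≤ (i : ℕ) then μ i else 0 := fun i => by
      by_cases hi : (i : ℕ) < ℓ
      · rw [if_pos hi, if_neg (by omega), sub_zero]
        exact mul_le_mul_of_nonneg_right (hμ (Fin.mk_le_mk.mpr hi.le)) (by linarith [hc1 i])
      · rw [if_neg hi, if_pos (by omega)]
        have : μ i ≤ t := hμ (Fin.mk_le_mk.mpr (by omega))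
        nlinarith [hc0 i]
    have hsum := Finset.sum_le_sum fun i (_ : i ∈ Finset.univ) => hterm i
    rw [← Finset.mul_sum, Finset.sum_sub_distrib, Finset.sum_sub_distrib, hcard] at hsum
    have := mul_nonneg (hμ0 ⟨ℓ, h⟩) (sub_nonneg.mpr hc)
    linarith

/-- Approximating an orthogonal family with decreasing norms by vectors from a subspace spanned by
`ℓ` vectors costs at least the tail of the squared norms. -/
theorem sum_tail_norm_sq_le_of_orthogonal {m ℓ : ℕ} {b w : Fin m → E}
    (ho : ∀ i j, i ≠ j → ⟪b i, b j⟫_ℂ = 0) (hanti : Antitone fun i => ‖b i‖ ^ 2)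
    (ψ : Fin ℓ → E) (hw : ∀ i, w i ∈ Submodule.span ℂ (Set.range ψ)) :
    ∑ i ∈ Finset.univ.filter (fun i : Fin m => ℓ ≤ (i : ℕ)), ‖b i‖ ^ 2 ≤
      ∑ i, ‖b i - w i‖ ^ 2 := by
  set S := Submodule.span ℂ (Set.range ψ) with hS
  have hfin : FiniteDimensional ℂ S := FiniteDimensional.span_of_finite ℂ (Set.finite_range ψ)
  set e := stdOrthonormalBasis ℂ S
  have he : Orthonormal ℂ fun s => (e s : E) := e.orthonormal.comp_linearIsometry S.subtypeₗᵢ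
  set c : Fin m → ℝ := fun i => ∑ s, ‖⟪(e s : E), unitize (b i)⟫_ℂ‖ ^ 2 with hc
  have hc1 : ∀ i, c i ≤ 1 := fun i =>
    (he.sum_inner_products_le (unitize (b i)) (s := Finset.univ)).trans
      (pow_le_one₀ (norm_nonneg _) (norm_unitize_le _))
  have hcsum : ∑ i, c i ≤ ℓ := by
    rw [hc, Finset.sum_comm]
    have h1 : ∀ s, ∑ i, ‖⟪(e s : E), unitize (b i)⟫_ℂ‖ ^ 2 ≤ 1 := fun s => by
      have := sum_norm_inner_sq_le_of_orthonormal_or_zero (v := fun i => unitize (b i))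
        (fun i => unitize_eq_zero_or _) (fun i j hij => inner_unitize_eq_zero (ho i j hij)) (e s : E)
      simp only [norm_inner_symm (e s : E)]
      refine this.trans (le_of_eq ?_)
      rw [he.1 s, one_pow]
    refine (Finset.sum_le_sum fun s _ => h1 s).trans ?_
    have : Module.finrank ℂ S ≤ ℓ := by
      simpa [Set.finrank] using finrank_range_le_card (R := ℂ) ψ
    simpa using this
  refine (sum_tail_le_sum_mul_one_sub hanti (fun i => by positivity)
    (fun i => Finset.sum_nonneg fun s _ => by positivity) hc1 hcsum).trans ?_
  refine Finset.sum_le_sum fun i _ => ?_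
  have hinner : ∀ s, ‖⟪(e s : E), b i⟫_ℂ‖ ^ 2 = ‖b i‖ ^ 2 * ‖⟪(e s : E), unitize (b i)⟫_ℂ‖ ^ 2 :=
    fun s => by
      conv_lhs => rw [← norm_smul_unitize (b i), inner_smul_right, norm_mul, mul_pow]
      simp
  have hproj : ‖S.starProjection (b i)‖ ^ 2 = ‖b i‖ ^ 2 * c i := by
    rw [hc, Finset.mul_sum, ← Finset.sum_congr rfl fun s _ => hinner s,
      Submodule.starProjection_apply, ← Submodule.coe_norm, ← e.sum_sq_norm_inner_right]
    refine Finset.sum_congr rfl fun s _ => ?_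
    have := S.starProjection_inner_eq_zero (b i) (e s) (e s).2
    rw [inner_eq_zero_symm, inner_sub_right, sub_eq_zero] at this
    rw [this, Submodule.coe_inner]
    rfl
  have hpyth : ‖b i‖ ^ 2 = ‖S.starProjection (b i)‖ ^ 2 + ‖b i - S.starProjection (b i)‖ ^ 2 := by
    rw [← Submodule.starProjection_orthogonal_val]
    exact Submodule.norm_sq_eq_add_norm_sq_starProjection _ _
  have hmin : ‖b i - S.starProjection (b i)‖ ≤ ‖b i - w i‖ := by
    rw [Submodule.starProjection_minimal]
    exact ciInf_le ⟨0, by rintro _ ⟨y, rfl⟩; exact norm_nonneg _⟩ (⟨w i, hw i⟩ : S)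
  have := pow_le_pow_left₀ (norm_nonneg _) hmin 2
  linarith

end OrthogonalFamilies

section Tiling

/-- The unit box `(0, 1]ⁿ`. -/
def unitBox (n : ℕ) : Set (Rn n) := {x | ∀ i, x i ∈ Set.Ioc (0 : ℝ) 1}

theorem zcast_apply (k : Fin n → ℤ) (i : Fin n) : zcast k i = (k i : ℝ) := rfl

theorem zcast_add (k l : Fin n → ℤ) : zcast (k + l) = zcast k + zcast l := by
  ext i
  simp [zcast_apply]

theorem zcast_neg (k : Fin n → ℤ) : zcast (-k) = -zcast k := by
  ext i
  simp [zcast_apply]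

theorem unitBox_ae_eq_Icc :
    (unitBox n : Set (Rn n)) =ᵐ[volume] {x : Rn n | ∀ i, x i ∈ Set.Icc (0 : ℝ) 1} := by
  have h := (PiLp.volume_preserving_ofLp (Fin n)).quasiMeasurePreserving.preimage_ae_eq
    (Measure.univ_pi_Ioc_ae_eq_Icc (μ := fun _ : Fin n => (volume : Measure ℝ))
      (f := fun _ => 0) (g := fun _ => 1))
  have h₁ : (unitBox n : Set (Rn n)) =
      WithLp.ofLp ⁻¹' Set.univ.pi fun _ : Fin n => Set.Ioc (0 : ℝ) 1 := by
    ext x; simp [unitBox]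
  have h₂ : {x : Rn n | ∀ i, x i ∈ Set.Icc (0 : ℝ) 1} =
      WithLp.ofLp ⁻¹' Set.Icc (fun _ : Fin n => (0 : ℝ)) fun _ => 1 := by
    ext x; simp [Set.mem_Icc, Pi.le_def, forall_and]
  rw [h₁, h₂]
  exact h

theorem unitBox_ae_eq_fundamentalDomain : (unitBox n : Set (Rn n)) =ᵐ[volume]
    ZSpan.fundamentalDomain (EuclideanSpace.basisFun (Fin n) ℝ).toBasis := by
  refine unitBox_ae_eq_Icc.trans (Filter.EventuallyEq.symm ?_)
  have h := (PiLp.volume_preserving_ofLp (Fin n)).quasiMeasurePreserving.preimage_ae_eq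
    (Measure.univ_pi_Ico_ae_eq_Icc (μ := fun _ : Fin n => (volume : Measure ℝ))
      (f := fun _ => 0) (g := fun _ => 1))
  have h₁ : ZSpan.fundamentalDomain (EuclideanSpace.basisFun (Fin n) ℝ).toBasis =
      WithLp.ofLp ⁻¹' Set.univ.pi fun _ : Fin n => Set.Ico (0 : ℝ) 1 := by
    ext x; simp [ZSpan.mem_fundamentalDomain]
  have h₂ : {x : Rn n | ∀ i, x i ∈ Set.Icc (0 : ℝ) 1} =
      WithLp.ofLp ⁻¹' Set.Icc (fun _ : Fin n => (0 : ℝ)) fun _ => 1 := by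
    ext x; simp [Set.mem_Icc, Pi.le_def, forall_and]
  rw [h₁, h₂]
  exact h

/-- Periodization over `ℤⁿ` tiles the integral over `ℝⁿ`. -/
theorem lintegral_eq_lintegral_unitBox_tsum {g : Rn n → ℝ≥0∞} (hg : Measurable g) :
    ∫⁻ x, g x = ∫⁻ ξ in unitBox n, ∑' k : Fin n → ℤ, g (ξ + zcast k) := by
  set b := (EuclideanSpace.basisFun (Fin n) ℝ).toBasis with hb
  set e : (Fin n → ℤ) ≃ Submodule.span ℤ (Set.range b) :=
    (b.restrictScalars ℤ).equivFun.symm.toEquiv with he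
  have hez : ∀ k, ((e k : Submodule.span ℤ (Set.range b)) : Rn n) = zcast k := fun k => by
    simp only [he, LinearEquiv.coe_toEquiv, Module.Basis.equivFun_symm_apply]
    rw [Submodule.coe_sum]
    ext i
    simp [hb, zcast_apply, Pi.single_apply]
  have hfd := ZSpan.isAddFundamentalDomain' b (volume : Measure (Rn n))
  have : Countable (Submodule.span ℤ (Set.range b)).toAddSubgroup := e.symm.injective.countable
  rw [hfd.lintegral_eq_tsum'' g,
    lintegral_tsum (f := fun (k : Fin n → ℤ) ξ => g (ξ + zcast k))
      fun k => (hg.comp (measurable_add_const _)).aemeasurable,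
    ← Equiv.tsum_eq (β := (Submodule.span ℤ (Set.range b)).toAddSubgroup) e]
  refine tsum_congr fun k => ?_
  rw [setLIntegral_congr unitBox_ae_eq_fundamentalDomain]
  refine lintegral_congr fun x => ?_
  rw [add_comm, ← hez]
  rfl

/-- The map `(ξ, k) ↦ ξ + k` from `(0, 1]ⁿ × ℤⁿ` onto `ℝⁿ` preserves the measure. -/
theorem measurePreserving_unitBox_add :
    MeasurePreserving (fun p : Rn n × (Fin n → ℤ) => p.1 + zcast p.2)
      ((volume.restrict (unitBox n)).prod Measure.count) volume := by
  have hm : Measurable fun p : Rn n × (Fin n → ℤ) => p.1 + zcast p.2 :=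
    measurable_fst.add ((measurable_of_countable (zcast (n := n))).comp measurable_snd)
  refine ⟨hm, Measure.ext fun s hs => ?_⟩
  rw [Measure.map_apply hm hs, Measure.prod_apply (hm hs), ← lintegral_indicator_one hs,
    lintegral_eq_lintegral_unitBox_tsum (measurable_one.indicator hs)]
  refine lintegral_congr fun ξ => ?_
  rw [← lintegral_count, ← lintegral_indicator_one (measurable_prodMk_left (hm hs))]
  rfl

theorem lintegral_Iθ_eq {θ : ℝ} (hθ : Real.sin θ ≠ 0) {g : Rn n → ℝ≥0∞} (hg : Measurable g) :
    ∫⁻ ω in Iθ n θ, ∑' k : Fin n → ℤ, g ((Real.sin θ)⁻¹ • ω + zcast k) =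
      ENNReal.ofReal (|Real.sin θ| ^ n) * ∫⁻ x, g x := by
  set s := Real.sin θ
  set J : Set (Rn n) := {x : Rn n | ∀ i, x i ∈ Set.Icc (0 : ℝ) 1} with hJ
  have hIm : MeasurableSet (Iθ n θ) := by
    have : Iθ n θ = ⋂ i, (fun x : Rn n => x i) ⁻¹' Set.Icc (0 : ℝ) |s| := by
      ext x; simp [Iθ, s]
    rw [this]
    exact MeasurableSet.iInter fun i => (by fun_prop : Measurable fun x : Rn n => x i)
      measurableSet_Icc
  have hJm : MeasurableSet J := by
    have : J = ⋂ i, (fun x : Rn n => x i) ⁻¹' Set.Icc (0 : ℝ) 1 := by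
      ext x; simp [hJ]
    rw [this]
    exact MeasurableSet.iInter fun i => (by fun_prop : Measurable fun x : Rn n => x i)
      measurableSet_Icc
  have hJint : ∀ {g : Rn n → ℝ≥0∞}, Measurable g →
      ∫⁻ ξ in J, ∑' k : Fin n → ℤ, g (ξ + zcast k) = ∫⁻ x, g x := fun {g} hg => by
    rw [← setLIntegral_congr unitBox_ae_eq_Icc, ← lintegral_eq_lintegral_unitBox_tsum hg]
  set H : Rn n → ℝ≥0∞ := fun ξ => ∑' k : Fin n → ℤ, g (ξ + zcast k) with hH
  have hHm : Measurable H := Measurable.tsum fun k => hg.comp (measurable_id.add_const _)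
  set K : Rn n → ℝ≥0∞ := fun x => (Iθ n θ).indicator 1 (s • x) * H x with hK
  have hKm : Measurable K :=
    ((measurable_one.indicator hIm).comp (measurable_const_smul s)).mul hHm
  have h1 : ∫⁻ ω in Iθ n θ, H (s⁻¹ • ω) = ∫⁻ ω, K (s⁻¹ • ω) := by
    rw [← lintegral_indicator hIm]
    refine lintegral_congr fun ω => ?_
    simp only [hK, smul_inv_smul₀ hθ]
    by_cases h : ω ∈ Iθ n θ <;> simp [h]
  have h2 : ∫⁻ ω, K (s⁻¹ • ω) = ENNReal.ofReal (|s| ^ n) * ∫⁻ x, K x := by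
    rw [← lintegral_map hKm (measurable_const_smul s⁻¹),
      Measure.map_addHaar_smul volume (inv_ne_zero hθ), lintegral_smul_measure]
    simp [abs_pow]
  have h3 : ∫⁻ x, K x = ∫⁻ x, g x := by
    rcases lt_or_gt_of_ne hθ with hneg | hpos
    · have hmem : ∀ x : Rn n, s • (-x) ∈ Iθ n θ ↔ x ∈ J := fun x => by
        simp only [Iθ, hJ, Set.mem_ofPred_eq, Set.mem_Icc]
        refine forall_congr' fun i => ?_
        change 0 ≤ s * (-x i) ∧ s * (-x i) ≤ |s| ↔ _
        rw [abs_of_neg hneg]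
        constructor
        · rintro ⟨h1, h2⟩; constructor <;> nlinarith
        · rintro ⟨h1, h2⟩; constructor <;> nlinarith
      have hneg' : ∀ {f : Rn n → ℝ≥0∞}, ∫⁻ x, f (-x) = ∫⁻ x, f x := fun {f} =>
        (Measure.measurePreserving_neg volume).lintegral_comp_emb
          (MeasurableEquiv.neg (Rn n)).measurableEmbedding f
      rw [← hneg', ← hneg' (f := g), ← hJint (g := fun x => g (-x)) (hg.comp measurable_neg),
        ← lintegral_indicator hJm]
      refine lintegral_congr fun x => ?_
      have hHx : H (-x) = ∑' k : Fin n → ℤ, g (-(x + zcast k)) := by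
        rw [← (Equiv.neg (Fin n → ℤ)).tsum_eq fun k => g (-(x + zcast k))]
        refine tsum_congr fun k => ?_
        rw [Equiv.neg_apply, zcast_neg, neg_add, neg_neg]
      simp only [hK]
      by_cases h : x ∈ J
      · rw [Set.indicator_of_mem ((hmem x).mpr h), Set.indicator_of_mem h, hHx]
        simp
      · rw [Set.indicator_of_notMem (fun h' => h ((hmem x).mp h')), Set.indicator_of_notMem h,
          zero_mul]
    · have hmem : ∀ x : Rn n, s • x ∈ Iθ n θ ↔ x ∈ J := fun x => by
        simp only [Iθ, hJ, Set.mem_ofPred_eq, Set.mem_Icc]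
        refine forall_congr' fun i => ?_
        change 0 ≤ s * x i ∧ s * x i ≤ |s| ↔ _
        rw [abs_of_pos hpos]
        constructor
        · rintro ⟨h1, h2⟩; constructor <;> nlinarith
        · rintro ⟨h1, h2⟩; constructor <;> nlinarith
      rw [← hJint hg, ← lintegral_indicator hJm]
      refine lintegral_congr fun x => ?_
      simp only [hK]
      by_cases h : x ∈ J
      · rw [Set.indicator_of_mem ((hmem x).mpr h), Set.indicator_of_mem h,
          Pi.one_apply, one_mul]
      · rw [Set.indicator_of_notMem (fun h' => h ((hmem x).mp h')), Set.indicator_of_notMem h,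
          zero_mul]
  rw [← h3, ← h2, ← h1]

end Tiling

section FourierSide

/-- The space `L²(ℝⁿ)`. -/
abbrev L2 (n : ℕ) : Type := Lp ℂ 2 (volume : Measure (Rn n))

/-- Multiplication by a measurable unimodular function, as a linear isometry of `L²(ℝⁿ)`. -/
def unimodularMul (u : Rn n → ℂ) (hu : Measurable u) (h1 : ∀ x, ‖u x‖ = 1) :
    L2 n →ₗᵢ[ℂ] L2 n :=
  have hmem : ∀ f : L2 n, MemLp (fun x => u x * f x) 2 volume := fun f =>
    (Lp.memLp f).of_le (hu.aestronglyMeasurable.mul (Lp.aestronglyMeasurable f))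
      (Filter.Eventually.of_forall fun x => by rw [norm_mul, h1, one_mul])
  { toFun := fun f => (hmem f).toLp _
    map_add' := fun f g => by
      ext1
      filter_upwards [(hmem (f + g)).coeFn_toLp, (hmem f).coeFn_toLp, (hmem g).coeFn_toLp,
        Lp.coeFn_add f g, Lp.coeFn_add ((hmem f).toLp _) ((hmem g).toLp _)]
        with x h₁ h₂ h₃ h₄ h₅
      rw [h₁, h₅, Pi.add_apply, h₂, h₃, h₄, Pi.add_apply, mul_add]
    map_smul' := fun c f => by
      ext1
      filter_upwards [(hmem (c • f)).coeFn_toLp, (hmem f).coeFn_toLp,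
        Lp.coeFn_smul c f, Lp.coeFn_smul c ((hmem f).toLp _)] with x h₁ h₂ h₃ h₄
      rw [h₁, RingHom.id_apply, h₄, Pi.smul_apply, h₂, h₃, Pi.smul_apply, smul_eq_mul,
        smul_eq_mul, mul_left_comm]
    norm_map' := fun f => by
      change ‖(hmem f).toLp _‖ = _
      rw [Lp.norm_toLp, Lp.norm_def]
      congr 1
      exact eLpNorm_congr_norm_ae (Filter.Eventually.of_forall fun x => by
        rw [norm_mul, h1, one_mul]) }

theorem coeFn_unimodularMul (u : Rn n → ℂ) (hu : Measurable u) (h1 : ∀ x, ‖u x‖ = 1)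
    (f : L2 n) : unimodularMul u hu h1 f =ᵐ[volume] fun x => u x * f x :=
  ((Lp.memLp f).of_le (hu.aestronglyMeasurable.mul (Lp.aestronglyMeasurable f))
    (Filter.Eventually.of_forall fun x => by
      rw [Pi.mul_apply, norm_mul, h1, one_mul])).coeFn_toLp

theorem coeFn_chirpLp (θ : ℝ) (f : L2 n) : chirpLp θ f =ᵐ[volume] chirp θ f :=
  MemLp.coeFn_toLp _

theorem coeFn_thetaTransLp (θ : ℝ) (s : Rn n) (f : L2 n) :
    thetaTransLp θ s f =ᵐ[volume] thetaTrans θ s f :=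
  MemLp.coeFn_toLp _

theorem chirpLp_neg_chirpLp (θ : ℝ) (f : L2 n) : chirpLp (-θ) (chirpLp θ f) = f := by
  ext1
  filter_upwards [coeFn_chirpLp (-θ) (chirpLp θ f), coeFn_chirpLp θ f] with x h₁ h₂
  rw [h₁, chirp, h₂, chirp, ← mul_assoc, ← Complex.exp_add]
  have : Real.cot (-θ) = -Real.cot θ := by simp [Real.cot_eq_cos_div_sin, div_neg]
  simp [this]

/-- Chirp modulation as a surjective linear isometry of `L²(ℝⁿ)`. -/
def chirpEquiv (n : ℕ) (θ : ℝ) : L2 n ≃ₗᵢ[ℂ] L2 n :=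
  have hu : Measurable fun t : Rn n =>
      Complex.exp (((Real.pi * ⟪t, t⟫_ℝ * Real.cot θ : ℝ) : ℂ) * Complex.I) := by fun_prop
  have heq : ∀ f : L2 n, chirpLp θ f = unimodularMul _ hu
      (fun _ => Complex.norm_exp_ofReal_mul_I _) f := fun _ => rfl
  { toFun := chirpLp θ
    invFun := chirpLp (-θ)
    left_inv := chirpLp_neg_chirpLp θ
    right_inv := fun f => by simpa using chirpLp_neg_chirpLp (-θ) f
    map_add' := fun f g => by simp only [heq, map_add]
    map_smul' := fun c f => by simp only [heq, map_smul, RingHom.id_apply]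
    norm_map' := fun f => by
      change ‖chirpLp θ f‖ = _
      rw [heq, LinearIsometry.norm_map] }

/-- The Fourier character `ξ ↦ e^{-2πi s·ξ}`. -/
def character (s ξ : Rn n) : ℂ := Complex.exp (((-2 * Real.pi * ⟪s, ξ⟫_ℝ : ℝ) : ℂ) * Complex.I)

theorem measurable_character (s : Rn n) : Measurable (character s) := by
  unfold character; fun_prop

theorem norm_character (s ξ : Rn n) : ‖character s ξ‖ = 1 := Complex.norm_exp_ofReal_mul_I _

theorem character_add_zcast (k l : Fin n → ℤ) (ξ : Rn n) :
    character (zcast k) (ξ + zcast l) = character (zcast k) ξ := by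
  have : ⟪zcast k, zcast l⟫_ℝ = ((∑ i, k i * l i : ℤ) : ℝ) := by
    simp [PiLp.inner_apply, zcast_apply, mul_comm]
  rw [character, character, inner_add_right, this, Complex.exp_eq_exp_iff_exists_int]
  refine ⟨-∑ i, k i * l i, ?_⟩
  push_cast
  ring

theorem IsPlancherel.translate
    {𝓕 : L2 n ≃ₗᵢ[ℂ] L2 n} (h𝓕 : IsPlancherel 𝓕) (s : Rn n) (f : L2 n) :
    𝓕 (Lp.compMeasurePreserving (fun t => t - s) (measurePreserving_sub_right volume s) f)
      =ᵐ[volume] fun ξ => character s ξ * 𝓕 f ξ := by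
  set τ : L2 n →ₗᵢ[ℂ] L2 n := Lp.compMeasurePreservingₗᵢ ℂ (fun t => t - s)
    (measurePreserving_sub_right volume s)
  set M : L2 n →ₗᵢ[ℂ] L2 n := unimodularMul (character s) (measurable_character s)
    (norm_character s)
  suffices h : 𝓕 (τ f) = M (𝓕 f) by
    have h' := coeFn_unimodularMul (character s) (measurable_character s) (norm_character s) (𝓕 f)
    change 𝓕 (τ f) =ᵐ[volume] _
    rw [h]
    exact h'
  have hintg : ∀ (g : Rn n → ℂ) (hg : MemLp g 2 volume), Integrable g volume →
      𝓕 (τ (hg.toLp g)) = M (𝓕 (hg.toLp g)) := fun g hg hgi => by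
    have hg' := hg.comp_measurePreserving (measurePreserving_sub_right volume s)
    have hτ : τ (hg.toLp g) = hg'.toLp _ :=
      Lp.toLp_compMeasurePreserving hg (measurePreserving_sub_right volume s)
    rw [hτ]
    ext1
    filter_upwards [h𝓕 _ hg' (hgi.comp_sub_right s), h𝓕 g hg hgi,
      coeFn_unimodularMul (character s) (measurable_character s) (norm_character s)
        (𝓕 (hg.toLp g))] with ξ h₁ h₂ h₃
    rw [h₁, h₃, h₂, ← integral_const_mul, ← integral_sub_right_eq_self
      (fun t => character s ξ * (g t * Complex.exp (((-2 * Real.pi * ⟪t, ξ⟫_ℝ : ℝ) : ℂ) * I))) s]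
    refine integral_congr_ae (Filter.Eventually.of_forall fun t => ?_)
    simp only [Function.comp_apply, character]
    rw [mul_left_comm, ← Complex.exp_add, inner_sub_left]
    congr 2
    push_cast
    ring
  refine Lp.induction (by norm_num) (fun f : L2 n => 𝓕 (τ f) = M (𝓕 f)) ?_ ?_ ?_ f
  · intro c S hS hSfin
    exact hintg _ (memLp_indicator_const 2 hS c (Or.inr hSfin.ne))
      ((integrable_indicator_iff hS).mpr (integrableOn_const hSfin.ne))
  · intro f g hf hg _ ih₁ ih₂
    simp only [map_add, ih₁, ih₂]
  · exact isClosed_eq (𝓕.continuous.comp τ.continuous) (M.continuous.comp 𝓕.continuous)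

/-- The chirp-modulated Fourier transform `f ↦ (C_θ f)^`. -/
def chirpFourier (𝓕 : L2 n ≃ₗᵢ[ℂ] L2 n) (θ : ℝ) : L2 n ≃ₗᵢ[ℂ] L2 n := (chirpEquiv n θ).trans 𝓕

theorem chirpFourier_apply (𝓕 : L2 n ≃ₗᵢ[ℂ] L2 n) (θ : ℝ) (f : L2 n) :
    chirpFourier 𝓕 θ f = 𝓕 (chirpLp θ f) := rfl

/-- The chirp-modulated Fourier transform turns θ-translations into modulations, up to a
unimodular constant. -/
theorem IsPlancherel.exists_chirpFourier_thetaTransLp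
    {𝓕 : L2 n ≃ₗᵢ[ℂ] L2 n} (h𝓕 : IsPlancherel 𝓕) (θ : ℝ) (s : Rn n) :
    ∃ c : ℂ, ‖c‖ = 1 ∧ ∀ f : L2 n, chirpFourier 𝓕 θ (thetaTransLp θ s f) =ᵐ[volume]
      fun ξ => c * (character s ξ * chirpFourier 𝓕 θ f ξ) := by
  set c : ℂ := Complex.exp (((Real.pi * ⟪s, s⟫_ℝ * Real.cot θ : ℝ) : ℂ) * Complex.I)
  refine ⟨c, Complex.norm_exp_ofReal_mul_I _, fun f => ?_⟩
  have hs := measurePreserving_sub_right (volume : Measure (Rn n)) s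
  have h : chirpLp θ (thetaTransLp θ s f) =
      c • Lp.compMeasurePreserving (fun t => t - s) hs (chirpLp θ f) := by
    ext1
    filter_upwards [coeFn_chirpLp θ (thetaTransLp θ s f), coeFn_thetaTransLp θ s f,
      Lp.coeFn_smul c (Lp.compMeasurePreserving (fun t => t - s) hs (chirpLp θ f)),
      Lp.coeFn_compMeasurePreserving (chirpLp θ f) hs,
      hs.quasiMeasurePreserving.ae (coeFn_chirpLp θ f)] with t h₁ h₂ h₃ h₄ h₅
    rw [h₁, chirp, h₂, thetaTrans, h₃, Pi.smul_apply, h₄, Function.comp_apply, h₅, chirp,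
      smul_eq_mul, ← mul_assoc, ← mul_assoc, ← Complex.exp_add, ← Complex.exp_add]
    congr 2
    simp only [inner_sub_left, inner_sub_right, real_inner_comm s t]
    push_cast
    ring
  rw [chirpFourier_apply, h, map_smul]
  filter_upwards [Lp.coeFn_smul c (𝓕 (Lp.compMeasurePreserving (fun t => t - s) hs (chirpLp θ f))),
    h𝓕.translate s (chirpLp θ f)] with ξ h₁ h₂
  rw [h₁, Pi.smul_apply, h₂, smul_eq_mul, chirpFourier_apply]

end FourierSide

section Fibers

/-- The sequence space `ℓ²(ℤⁿ)`. -/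
abbrev SeqL2 (n : ℕ) : Type := lp (fun _ : Fin n → ℤ => ℂ) 2

theorem memℓp_two_iff_tsum_enorm_ne_top (x : (Fin n → ℤ) → ℂ) :
    Memℓp x 2 ↔ ∑' k, ‖x k‖ₑ ^ 2 ≠ ∞ := by
  have h := ENNReal.tsum_coe_ne_top_iff_summable_coe (f := fun k => ‖x k‖₊ ^ 2)
  rw [memℓp_gen_iff (by norm_num)]
  simpa [enorm_eq_nnnorm] using h.symm

theorem enorm_sq_eq_tsum (x : SeqL2 n) : ‖x‖ₑ ^ 2 = ∑' k, ‖x k‖ₑ ^ 2 := by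
  have h := lp.norm_rpow_eq_tsum (p := 2) (by norm_num) x
  have hs := (memℓp_gen_iff (p := 2) (by norm_num)).mp (lp.memℓp x)
  simp only [ENNReal.toReal_ofNat, Real.rpow_ofNat] at h hs
  rw [← ofReal_norm, ← ENNReal.ofReal_pow (norm_nonneg _), h,
    ENNReal.ofReal_tsum_of_nonneg (fun _ => by positivity) hs]
  exact tsum_congr fun k => by rw [← ofReal_norm, ← ENNReal.ofReal_pow (norm_nonneg _)]

/-- A measurable function on `ℝⁿ` all of whose samples along cosets of `ℤⁿ` are square summable. -/
structure FiberSummable (F : Rn n → ℂ) : Prop where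
  measurable : Measurable F
  memℓp : ∀ ξ, Memℓp (fun k : Fin n → ℤ => F (ξ + zcast k)) 2

open Classical in
/-- The sequence of samples `(F(ξ + k))_k` of `F` as an element of `ℓ²(ℤⁿ)`; it is `0` when this
sequence is not square summable. -/
def samples (F : Rn n → ℂ) (ξ : Rn n) : SeqL2 n :=
  if h : Memℓp (fun k : Fin n → ℤ => F (ξ + zcast k)) 2 then ⟨_, h⟩ else 0

theorem FiberSummable.samples_apply {F : Rn n → ℂ} (hF : FiberSummable F) (ξ : Rn n)
    (k : Fin n → ℤ) : samples F ξ k = F (ξ + zcast k) := by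
  rw [samples, dif_pos (hF.memℓp ξ)]

theorem FiberSummable.inner_samples {F G : Rn n → ℂ} (hF : FiberSummable F)
    (hG : FiberSummable G) (ξ : Rn n) :
    ⟪samples F ξ, samples G ξ⟫_ℂ = ∑' k, ⟪F (ξ + zcast k), G (ξ + zcast k)⟫_ℂ := by
  rw [lp.inner_eq_tsum]
  exact tsum_congr fun k => by rw [hF.samples_apply, hG.samples_apply]

theorem FiberSummable.measurable_inner_samples {F G : Rn n → ℂ} (hF : FiberSummable F)
    (hG : FiberSummable G) : Measurable fun ξ => ⟪samples F ξ, samples G ξ⟫_ℂ := by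
  simp only [hF.inner_samples hG]
  exact Measurable.tsum fun k => (hF.measurable.comp (measurable_add_const _)).inner
    (hG.measurable.comp (measurable_add_const _))

theorem FiberSummable.measurable_norm_samples {F : Rn n → ℂ} (hF : FiberSummable F) :
    Measurable fun ξ => ‖samples F ξ‖ := by
  have := (Complex.measurable_re.comp (hF.measurable_inner_samples hF)).sqrt
  convert this using 2 with ξ
  exact norm_eq_sqrt_re_inner (𝕜 := ℂ) _

theorem FiberSummable.inner_samples_add_zcast {F G : Rn n → ℂ} (hF : FiberSummable F)
    (hG : FiberSummable G) (ξ : Rn n) (l : Fin n → ℤ) :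
    ⟪samples F (ξ + zcast l), samples G (ξ + zcast l)⟫_ℂ = ⟪samples F ξ, samples G ξ⟫_ℂ := by
  rw [hF.inner_samples hG, hF.inner_samples hG, ← (Equiv.addLeft l).tsum_eq
    fun k => ⟪F (ξ + zcast k), G (ξ + zcast k)⟫_ℂ]
  exact tsum_congr fun k => by rw [Equiv.coe_addLeft, zcast_add, add_assoc]

/-- Invariance under translation by `ℤⁿ`. -/
def IsPeriodic {α : Type*} (p : Rn n → α) : Prop :=
  ∀ (ξ : Rn n) (l : Fin n → ℤ), p (ξ + zcast l) = p ξ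

theorem FiberSummable.sum_mul {ι : Type*} [Fintype ι] {c : ι → Rn n → ℂ}
    {F : ι → Rn n → ℂ} (hF : ∀ j, FiberSummable (F j)) (hc : ∀ j, Measurable (c j))
    (hper : ∀ j, IsPeriodic (c j)) : FiberSummable (fun ξ => ∑ j, c j ξ * F j ξ) := by
  refine ⟨Finset.measurable_sum _ fun j _ => (hc j).mul (hF j).measurable, fun ξ => ?_⟩
  have := lp.memℓp (∑ j, c j ξ • samples (F j) ξ)
  convert this using 1
  ext k
  simp only [hper _ ξ k]
  rw [lp.coeFn_sum, Finset.sum_apply]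
  exact Finset.sum_congr rfl fun j _ => by
    rw [lp.coeFn_smul, Pi.smul_apply, (hF j).samples_apply, smul_eq_mul]

theorem samples_sum_mul {ι : Type*} [Fintype ι] {c : ι → Rn n → ℂ}
    {F : ι → Rn n → ℂ} (hF : ∀ j, FiberSummable (F j)) (hc : ∀ j, Measurable (c j))
    (hper : ∀ j, IsPeriodic (c j)) (ξ : Rn n) :
    samples (fun ξ => ∑ j, c j ξ * F j ξ) ξ = ∑ j, c j ξ • samples (F j) ξ := by
  ext k
  rw [(FiberSummable.sum_mul hF hc hper).samples_apply, lp.coeFn_sum, Finset.sum_apply]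
  exact Finset.sum_congr rfl fun j _ => by
    rw [lp.coeFn_smul, Pi.smul_apply, (hF j).samples_apply, smul_eq_mul, hper]

theorem FiberSummable.mul {c F : Rn n → ℂ} (hF : FiberSummable F) (hc : Measurable c)
    (hper : IsPeriodic c) : FiberSummable (fun ξ => c ξ * F ξ) := by
  simpa using FiberSummable.sum_mul (ι := Unit) (fun _ => hF) (fun _ => hc) fun _ => hper

theorem FiberSummable.samples_mul {c F : Rn n → ℂ} (hF : FiberSummable F) (hc : Measurable c)
    (hper : IsPeriodic c) (ξ : Rn n) : samples (fun ξ => c ξ * F ξ) ξ = c ξ • samples F ξ := by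
  simpa using samples_sum_mul (ι := Unit) (fun _ => hF) (fun _ => hc) (fun _ => hper) ξ

theorem FiberSummable.sub {F G : Rn n → ℂ} (hF : FiberSummable F) (hG : FiberSummable G) :
    FiberSummable (fun ξ => F ξ - G ξ) :=
  ⟨hF.measurable.sub hG.measurable, fun ξ => (hF.memℓp ξ).sub (hG.memℓp ξ)⟩

theorem FiberSummable.samples_sub {F G : Rn n → ℂ} (hF : FiberSummable F)
    (hG : FiberSummable G) (ξ : Rn n) :
    samples (fun ξ => F ξ - G ξ) ξ = samples F ξ - samples G ξ := by
  ext k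
  rw [(hF.sub hG).samples_apply, lp.coeFn_sub, Pi.sub_apply, hF.samples_apply, hG.samples_apply]

theorem FiberSummable.lintegral_enorm_sq {F : Rn n → ℂ} (hF : FiberSummable F) :
    ∫⁻ x, ‖F x‖ₑ ^ 2 = ∫⁻ ξ in unitBox n, ‖samples F ξ‖ₑ ^ 2 := by
  rw [lintegral_eq_lintegral_unitBox_tsum (hF.measurable.enorm.pow_const 2)]
  refine lintegral_congr fun ξ => ?_
  rw [enorm_sq_eq_tsum]
  exact tsum_congr fun k => by rw [hF.samples_apply]

/-- A property that is invariant under `ℤⁿ` and holds almost everywhere on the unit box holds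
almost everywhere. -/
theorem ae_of_ae_unitBox {S : Set (Rn n)} (hS : MeasurableSet S)
    (hper : ∀ ξ (l : Fin n → ℤ), ξ + zcast l ∈ S ↔ ξ ∈ S)
    (h : ∀ᵐ ξ ∂(volume.restrict (unitBox n)), ξ ∈ S) : ∀ᵐ ξ : Rn n, ξ ∈ S := by
  have h0 : ∫⁻ ξ : Rn n, Sᶜ.indicator 1 ξ = 0 := by
    rw [lintegral_eq_lintegral_unitBox_tsum (measurable_one.indicator hS.compl)]
    refine (lintegral_congr_ae (g := 0) ?_).trans lintegral_zero
    filter_upwards [h] with ξ hξ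
    refine ENNReal.tsum_eq_zero.mpr fun k => Set.indicator_of_notMem ?_ _
    simpa using (hper ξ k).mpr hξ
  rw [lintegral_indicator_one hS.compl] at h0
  exact h0

theorem enorm_sq_eq_lintegral (f : L2 n) : ‖f‖ₑ ^ 2 = ∫⁻ x, ‖f x‖ₑ ^ 2 := by
  have h := eLpNorm_eq_lintegral_rpow_enorm_toReal (p := 2) (μ := volume) (f := f)
    (by norm_num) (by norm_num)
  rw [Lp.enorm_def, h]
  simp only [ENNReal.toReal_ofNat, ENNReal.rpow_ofNat]
  rw [← ENNReal.rpow_ofNat, ← ENNReal.rpow_mul]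
  norm_num

theorem exists_fiberSummable (f : L2 n) : ∃ F : Rn n → ℂ, FiberSummable F ∧ f =ᵐ[volume] F := by
  have hfm : Measurable (f : Rn n → ℂ) := (Lp.stronglyMeasurable f).measurable
  set q : Rn n → ℝ≥0∞ := fun ξ => ∑' k : Fin n → ℤ, ‖f (ξ + zcast k)‖ₑ ^ 2 with hq
  have hqm : Measurable q := Measurable.tsum fun k =>
    (hfm.comp (measurable_add_const _)).enorm.pow_const 2
  have hqper : IsPeriodic q := fun ξ l => by
    simp only [hq]
    rw [← (Equiv.addLeft l).tsum_eq fun k => ‖f (ξ + zcast k)‖ₑ ^ 2]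
    exact tsum_congr fun k => by rw [Equiv.coe_addLeft, zcast_add, add_assoc]
  set S : Set (Rn n) := {ξ | q ξ < ∞} with hSdef
  have hS : MeasurableSet S := measurableSet_lt hqm measurable_const
  have hSper : ∀ ξ (l : Fin n → ℤ), ξ + zcast l ∈ S ↔ ξ ∈ S := fun ξ l => by
    simp only [hSdef, Set.mem_ofPred_eq, hqper ξ l]
  have hSae : ∀ᵐ ξ : Rn n, ξ ∈ S := by
    refine ae_of_ae_unitBox hS hSper (ae_lt_top hqm ?_)
    rw [← lintegral_eq_lintegral_unitBox_tsum (hfm.enorm.pow_const 2), ← enorm_sq_eq_lintegral]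
    exact ENNReal.pow_ne_top enorm_ne_top
  refine ⟨S.indicator f, ⟨hfm.indicator hS, fun ξ => ?_⟩, ?_⟩
  · rw [memℓp_two_iff_tsum_enorm_ne_top]
    by_cases h : ξ ∈ S
    · simp only [Set.indicator_of_mem ((hSper ξ _).mpr h)]
      exact (show q ξ < ∞ from h).ne
    · simp [Set.indicator_of_notMem (mt (hSper ξ _).mp h)]
  · filter_upwards [hSae] with ξ hξ
    rw [Set.indicator_of_mem hξ]

theorem FiberSummable.enorm_sq_eq {F : Rn n → ℂ} (hF : FiberSummable F) {f : L2 n}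
    (hf : f =ᵐ[volume] F) : ‖f‖ₑ ^ 2 = ∫⁻ ξ in unitBox n, ‖samples F ξ‖ₑ ^ 2 := by
  rw [enorm_sq_eq_lintegral, ← hF.lintegral_enorm_sq]
  exact lintegral_congr_ae (hf.mono fun x hx => by simp only [hx])

theorem FiberSummable.memLp {F : Rn n → ℂ} (hF : FiberSummable F)
    (h : ∫⁻ ξ in unitBox n, ‖samples F ξ‖ₑ ^ 2 ≠ ∞) : MemLp F 2 volume := by
  refine ⟨hF.measurable.aestronglyMeasurable, ?_⟩
  rw [eLpNorm_lt_top_iff_lintegral_rpow_enorm_lt_top (by norm_num) (by norm_num)]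
  simpa [hF.lintegral_enorm_sq] using h.lt_top

theorem FiberSummable.inner_eq {F G : Rn n → ℂ} (hF : FiberSummable F) (hG : FiberSummable G)
    {f g : L2 n} (hf : f =ᵐ[volume] F) (hg : g =ᵐ[volume] G) :
    ⟪f, g⟫_ℂ = ∫ ξ in unitBox n, ⟪samples F ξ, samples G ξ⟫_ℂ := by
  have hae : (fun x => ⟪f x, g x⟫_ℂ) =ᵐ[volume] fun x => ⟪F x, G x⟫_ℂ := by
    filter_upwards [hf, hg] with x h₁ h₂
    rw [h₁, h₂]
  have hintg : Integrable (fun x => ⟪F x, G x⟫_ℂ) volume := (L2.integrable_inner f g).congr hae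
  have hmp := measurePreserving_unitBox_add (n := n)
  have hintg' := hmp.integrable_comp_of_integrable hintg
  have hmap : ∫ x, ⟪F x, G x⟫_ℂ = ∫ p, ((fun x => ⟪F x, G x⟫_ℂ) ∘ fun p => p.1 + zcast p.2) p
      ∂((volume.restrict (unitBox n)).prod Measure.count) := by
    have := integral_map hmp.aemeasurable (f := fun x => ⟪F x, G x⟫_ℂ)
      (by rw [hmp.map_eq]; exact hintg.aestronglyMeasurable)
    rwa [hmp.map_eq] at this
  rw [L2.inner_def, integral_congr_ae hae, hmap, integral_prod _ hintg']
  refine integral_congr_ae ?_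
  filter_upwards [hintg'.prod_right_ae] with ξ hξ
  rw [hF.inner_samples hG, integral_countable hξ]
  simp [Measure.real]

end Fibers

section Torus

/-- The Haar probability measure on the unit circle, as used for multivariate Fourier series. -/
local instance unitAddCircleMeasureSpace : MeasureSpace UnitAddCircle :=
  ⟨AddCircle.haarAddCircle⟩

theorem mFourier_neg_eq_character (k : Fin n → ℤ) (x : Fin n → ℝ) :
    UnitAddTorus.mFourier (-k) (fun i => (x i : UnitAddCircle)) =
      character (zcast k) (WithLp.toLp 2 x) := by
  simp only [UnitAddTorus.mFourier, ContinuousMap.coe_mk, fourier_coe_apply, character]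
  rw [← Complex.exp_sum]
  congr 1
  simp only [PiLp.inner_apply, zcast_apply, Pi.neg_apply]
  push_cast
  simp only [Finset.mul_sum, Finset.sum_mul]
  refine Finset.sum_congr rfl fun i _ => ?_
  simp
  ring

theorem lintegral_unitBox_eq (g : Rn n → ℝ≥0∞) :
    ∫⁻ ξ in unitBox n, g ξ =
      ∫⁻ x in {x : Fin n → ℝ | ∀ i, x i ∈ Set.Ioc (0 : ℝ) (0 + 1)}, g (WithLp.toLp 2 x) := by
  rw [← (PiLp.volume_preserving_toLp (Fin n)).setLIntegral_comp_preimage_emb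
    (MeasurableEquiv.toLp 2 (Fin n → ℝ)).measurableEmbedding]
  simp [unitBox]

theorem integral_unitBox_eq (g : Rn n → ℂ) :
    ∫ ξ in unitBox n, g ξ =
      ∫ x in {x : Fin n → ℝ | ∀ i, x i ∈ Set.Ioc (0 : ℝ) (0 + 1)}, g (WithLp.toLp 2 x) := by
  rw [← (PiLp.volume_preserving_toLp (Fin n)).setIntegral_preimage_emb
    (MeasurableEquiv.toLp 2 (Fin n → ℝ)).measurableEmbedding]
  simp [unitBox]

/-- Parseval's identity on the unit box. -/
theorem tsum_enorm_sq_integral_unitBox {p : Rn n → ℂ} (hp : Measurable p)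
    (hp2 : ∫⁻ ξ in unitBox n, ‖p ξ‖ₑ ^ 2 ≠ ∞) :
    ∑' k : Fin n → ℤ, ‖∫ ξ in unitBox n, character (zcast k) ξ * p ξ‖ₑ ^ 2 =
      ∫⁻ ξ in unitBox n, ‖p ξ‖ₑ ^ 2 := by
  set P : UnitAddTorus (Fin n) → ℂ := fun x =>
    p (WithLp.toLp 2 (UnitAddTorus.measurableEquivPiIoc (fun _ : Fin n => (0 : ℝ)) x).1) with hP
  have hPm : Measurable P := hp.comp ((WithLp.measurable_toLp 2 _).comp
    (measurable_subtype_coe.comp (MeasurableEquiv.measurable _)))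
  have hPx : ∀ x ∈ {x : Fin n → ℝ | ∀ i, x i ∈ Set.Ioc (0 : ℝ) (0 + 1)},
      P (fun i => (x i : UnitAddCircle)) = p (WithLp.toLp 2 x) := fun x hx => by
    have := (UnitAddTorus.measurableEquivPiIoc (fun _ : Fin n => (0 : ℝ))).apply_symm_apply ⟨x, hx⟩
    rw [UnitAddTorus.coe_symm_measurableEquivPiIoc_apply] at this
    simp only [hP, this]
  have hbox : MeasurableSet {x : Fin n → ℝ | ∀ i, x i ∈ Set.Ioc (0 : ℝ) (0 + 1)} :=
    MeasurableSet.univ_pi' fun i => measurableSet_Ioc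
  have hnorm : ∫⁻ x, ‖P x‖ₑ ^ 2 = ∫⁻ ξ in unitBox n, ‖p ξ‖ₑ ^ 2 := by
    rw [lintegral_unitBox_eq, UnitAddTorus.lintegral_preimage _ fun _ => (0 : ℝ)]
    exact setLIntegral_congr_fun hbox fun x hx => by simp only [hPx x hx]
  have hPL : MemLp P 2 volume := by
    refine ⟨hPm.aestronglyMeasurable, ?_⟩
    rw [eLpNorm_lt_top_iff_lintegral_rpow_enorm_lt_top (by norm_num) (by norm_num)]
    simpa [hnorm] using hp2.lt_top
  have hcoeff : ∀ k, UnitAddTorus.mFourierCoeff (hPL.toLp P) k =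
      ∫ ξ in unitBox n, character (zcast k) ξ * p ξ := fun k => by
    have h₁ : UnitAddTorus.mFourierCoeff (hPL.toLp P) k = UnitAddTorus.mFourierCoeff P k := by
      refine integral_congr_ae ?_
      filter_upwards [hPL.coeFn_toLp] with x hx
      rw [hx]
    rw [h₁, UnitAddTorus.mFourierCoeff_eq_integral P k fun _ => (0 : ℝ), integral_unitBox_eq]
    refine setIntegral_congr_fun hbox fun x hx => ?_
    simp only [hPx x hx, mFourier_neg_eq_character, smul_eq_mul]
  have hsum := UnitAddTorus.hasSum_sq_mFourierCoeff (hPL.toLp P)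
  simp only [hcoeff] at hsum
  have h₂ : ∑' k : Fin n → ℤ, ‖∫ ξ in unitBox n, character (zcast k) ξ * p ξ‖ₑ ^ 2 =
      ENNReal.ofReal (∫ x, ‖hPL.toLp P x‖ ^ 2) := by
    rw [← hsum.tsum_eq, ENNReal.ofReal_tsum_of_nonneg (fun _ => by positivity) hsum.summable]
    exact tsum_congr fun k => by rw [← ofReal_norm, ← ENNReal.ofReal_pow (norm_nonneg _)]
  rw [h₂, ← hnorm, ofReal_integral_eq_lintegral_ofReal]
  · refine lintegral_congr_ae ?_
    filter_upwards [hPL.coeFn_toLp] with x hx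
    rw [hx, ← ofReal_norm, ← ENNReal.ofReal_pow (norm_nonneg _)]
  · exact (memLp_two_iff_integrable_sq_norm (Lp.aestronglyMeasurable _)).mp (Lp.memLp _)
  · exact Filter.Eventually.of_forall fun x => by positivity

end Torus

section BracketParseval

theorem FiberSummable.tsum_enorm_inner_sq {F G : Rn n → ℂ} (hF : FiberSummable F)
    (hG : FiberSummable G) (hG1 : ∀ ξ, ‖samples G ξ‖ ≤ 1) {f : L2 n} {g : (Fin n → ℤ) → L2 n}
    (hf : f =ᵐ[volume] F) {c : (Fin n → ℤ) → ℂ} (hc : ∀ k, ‖c k‖ = 1)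
    (hg : ∀ k, g k =ᵐ[volume] fun ξ => c k * (character (zcast k) ξ * G ξ)) :
    ∑' k : Fin n → ℤ, ‖⟪f, g k⟫_ℂ‖ₑ ^ 2 =
      ∫⁻ ξ in unitBox n, ‖⟪samples F ξ, samples G ξ⟫_ℂ‖ₑ ^ 2 := by
  rw [← tsum_enorm_sq_integral_unitBox (hF.measurable_inner_samples hG)]
  · refine tsum_congr fun k => ?_
    have hper : IsPeriodic fun ξ : Rn n => c k * character (zcast k) ξ := fun ξ l => by
      simp only [character_add_zcast]
    have hm : Measurable fun ξ : Rn n => c k * character (zcast k) ξ :=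
      (measurable_character _).const_mul _
    have hg' : g k =ᵐ[volume] fun ξ => (c k * character (zcast k) ξ) * G ξ := by
      simpa only [mul_assoc] using hg k
    rw [hF.inner_eq (hG.mul hm hper) hf hg']
    simp only [hG.samples_mul hm hper, inner_smul_right]
    simp only [mul_assoc]
    rw [integral_const_mul, enorm_mul, ← ofReal_norm (c k), hc, ENNReal.ofReal_one, one_mul]
  · refine ne_top_of_le_ne_top ?_ (lintegral_mono (g := fun ξ => ‖samples F ξ‖ₑ ^ 2) fun ξ => ?_)
    · rw [← hF.enorm_sq_eq hf]
      exact ENNReal.pow_ne_top enorm_ne_top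
    · refine pow_le_pow_left' ?_ 2
      rw [enorm_le_iff_norm_le]
      exact (norm_inner_le_norm _ _).trans (mul_le_of_le_one_right (norm_nonneg _) (hG1 ξ))

end BracketParseval

section Parseval

variable {E ι : Type*} [NormedAddCommGroup E] [InnerProductSpace ℂ E]

/-- The analysis operator `h ↦ (⟪e i, h⟫)_i` of a family satisfying Bessel's inequality. -/
theorem exists_analysis_operator {e : ι → E}
    (hB : ∀ h, ∑' i, ‖⟪h, e i⟫_ℂ‖ₑ ^ 2 ≤ ‖h‖ₑ ^ 2) :
    ∃ A : E →L[ℂ] lp (fun _ : ι => ℂ) 2, ∀ h,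
      ENNReal.ofReal (‖A h‖ ^ 2) = ∑' i, ‖⟪h, e i⟫_ℂ‖ₑ ^ 2 ∧ ‖A h‖ ≤ ‖h‖ := by
  have hmem : ∀ h, Memℓp (fun i => ⟪e i, h⟫_ℂ) 2 := fun h => by
    have h1 := ENNReal.tsum_coe_ne_top_iff_summable_coe (f := fun i => ‖⟪e i, h⟫_ℂ‖₊ ^ 2)
    rw [memℓp_gen_iff (by norm_num)]
    have h2 : Summable fun i => ((‖⟪e i, h⟫_ℂ‖₊ ^ 2 : NNReal) : ℝ) := by
      refine h1.mp (ne_top_of_le_ne_top (b := ‖h‖ₑ ^ 2) (ENNReal.pow_ne_top enorm_ne_top) ?_)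
      refine le_trans (le_of_eq (tsum_congr fun i => ?_)) (hB h)
      rw [enorm_eq_nnnorm, ENNReal.coe_pow, show ‖⟪h, e i⟫_ℂ‖₊ = ‖⟪e i, h⟫_ℂ‖₊ from
        NNReal.eq (norm_inner_symm _ _)]
    simpa using h2
  let A : E →ₗ[ℂ] lp (fun _ : ι => ℂ) 2 :=
    { toFun := fun h => ⟨_, hmem h⟩
      map_add' := fun x y => by ext i; exact inner_add_right _ _ _
      map_smul' := fun c x => by ext i; exact inner_smul_right _ _ _ }
  have hA : ∀ h, ENNReal.ofReal (‖A h‖ ^ 2) = ∑' i, ‖⟪h, e i⟫_ℂ‖ₑ ^ 2 := fun h => by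
    have h1 := lp.norm_rpow_eq_tsum (p := 2) (by norm_num) (A h)
    have hs := (memℓp_gen_iff (p := 2) (by norm_num)).mp (lp.memℓp (A h))
    simp only [ENNReal.toReal_ofNat, Real.rpow_ofNat] at h1 hs
    rw [h1, ENNReal.ofReal_tsum_of_nonneg (fun _ => by positivity) hs]
    refine tsum_congr fun i => ?_
    rw [← ofReal_norm, ← ENNReal.ofReal_pow (norm_nonneg _), ← norm_inner_symm]
    rfl
  have hle : ∀ h, ‖A h‖ ≤ ‖h‖ := fun h => by
    have h1 := hB h
    rw [← hA, ← ofReal_norm, ← ENNReal.ofReal_pow (norm_nonneg _),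
      ENNReal.ofReal_le_ofReal_iff (by positivity)] at h1
    exact le_of_sq_le_sq h1 (norm_nonneg _)
  exact ⟨A.mkContinuous 1 fun h => by simpa using hle h, fun h => ⟨hA h, hle h⟩⟩

/-- A Bessel family that satisfies Parseval's identity on its own members satisfies it on the
closed linear span. -/
theorem tsum_enorm_inner_sq_of_mem_closure_span {e : ι → E}
    (hB : ∀ h, ∑' i, ‖⟪h, e i⟫_ℂ‖ₑ ^ 2 ≤ ‖h‖ₑ ^ 2)
    (hP : ∀ j, ∑' i, ‖⟪e j, e i⟫_ℂ‖ₑ ^ 2 = ‖e j‖ₑ ^ 2) {h : E}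
    (hh : h ∈ (Submodule.span ℂ (Set.range e)).topologicalClosure) :
    ∑' i, ‖⟪h, e i⟫_ℂ‖ₑ ^ 2 = ‖h‖ₑ ^ 2 := by
  obtain ⟨A, hA⟩ := exists_analysis_operator hB
  have key : ∀ x, ∑' i, ‖⟪x, e i⟫_ℂ‖ₑ ^ 2 = ‖x‖ₑ ^ 2 ↔ ‖A x‖ = ‖x‖ := fun x => by
    rw [← (hA x).1, ← ofReal_norm, ← ENNReal.ofReal_pow (norm_nonneg _),
      ENNReal.ofReal_eq_ofReal_iff (by positivity) (by positivity),
      pow_left_inj₀ (norm_nonneg _) (norm_nonneg _) two_ne_zero]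
  let S : Submodule ℂ E :=
    { carrier := {x | ‖A x‖ = ‖x‖}
      zero_mem' := by simp
      add_mem' := fun {x y} hx hy => by
        simp only [Set.mem_ofPred_eq] at hx hy ⊢
        have h1 := parallelogram_law_with_norm ℂ x y
        have h2 := parallelogram_law_with_norm ℂ (A x) (A y)
        rw [← map_add, ← map_sub, hx, hy] at h2
        have h3 := (hA (x + y)).2
        have h4 := (hA (x - y)).2
        have h5 := mul_self_le_mul_self (norm_nonneg _) h4
        refine le_antisymm h3 (le_of_sq_le_sq ?_ (norm_nonneg _))
        nlinarith
      smul_mem' := fun c x hx => by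
        simp only [Set.mem_ofPred_eq] at hx ⊢
        rw [map_smul, norm_smul, norm_smul, hx] }
  have hS : IsClosed (S : Set E) := isClosed_eq A.continuous.norm continuous_norm
  have hle : Submodule.span ℂ (Set.range e) ≤ S := Submodule.span_le.mpr (by
    rintro _ ⟨j, rfl⟩
    exact (key _).mp (hP j))
  exact (key h).mpr (Submodule.topologicalClosure_minimal _ hle hS hh)

end Parseval

section OptimalSamples

variable {m : ℕ}

/-- The Gramian of the sample sequences of a finite family. -/
def sampleGram (F : Fin m → Rn n → ℂ) (ξ : Rn n) : Matrix (Fin m) (Fin m) ℂ :=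
  Matrix.of fun k l => ⟪samples (F l) ξ, samples (F k) ξ⟫_ℂ

theorem sampleGram_isHermitian (F : Fin m → Rn n → ℂ) (ξ : Rn n) :
    (sampleGram F ξ).IsHermitian := by
  ext i j
  simp [sampleGram, Matrix.conjTranspose_apply]

/-- The Gramian of sample sequences is diagonalized by a measurable `ℤⁿ`-periodic field of
unitaries, with measurable ordered eigenvalues. -/
theorem exists_periodic_diagonalization {F : Fin m → Rn n → ℂ} (hF : ∀ i, FiberSummable (F i)) :
    ∃ (U : Rn n → Matrix (Fin m) (Fin m) ℂ) (μ : Fin m → Rn n → ℝ),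
      (∀ i j, Measurable fun ξ => U ξ i j) ∧ (∀ i j, IsPeriodic fun ξ => U ξ i j) ∧
      (∀ i, Measurable (μ i)) ∧ ∀ ξ, U ξ ∈ Matrix.unitaryGroup (Fin m) ℂ ∧
        (Antitone fun i => μ i ξ) ∧
        star (U ξ) * sampleGram F ξ * U ξ = Matrix.diagonal fun i => ((μ i ξ : ℝ) : ℂ) := by
  let X := {G : Fin m → Fin m → ℂ // (Matrix.of G).IsHermitian}
  obtain ⟨U, μ, hU, hμ, h⟩ := exists_measurable_unitary_diagonalization
    (X := X) (fun G => Matrix.of G.1)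
    (fun i j => (measurable_pi_apply j).comp ((measurable_pi_apply (X := fun _ => Fin m → ℂ) i).comp
      measurable_subtype_coe)) (fun G => G.2)
  let g : Rn n → X := fun ξ => ⟨fun i j => sampleGram F ξ i j, sampleGram_isHermitian F ξ⟩
  have hg : Measurable g := Measurable.subtype_mk <| measurable_pi_lambda _ fun i =>
    measurable_pi_lambda _ fun j => (hF j).measurable_inner_samples (hF i)
  have hper : IsPeriodic g := fun ξ l => Subtype.ext <| funext fun i => funext fun j =>
    (hF j).inner_samples_add_zcast (hF i) ξ l
  exact ⟨fun ξ => U (g ξ), fun i ξ => μ i (g ξ), fun i j => (hU i j).comp hg,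
    fun i j ξ l => by simp only [hper ξ l], fun i => (hμ i).comp hg, fun ξ => h (g ξ)⟩

theorem fiberSummable_zero : FiberSummable (fun _ : Rn n => (0 : ℂ)) :=
  ⟨measurable_const, fun _ => zero_memℓp⟩

theorem samples_zero (ξ : Rn n) : samples (fun _ : Rn n => (0 : ℂ)) ξ = 0 := by
  ext k
  rw [fiberSummable_zero.samples_apply]
  rfl

theorem FiberSummable.unitize_samples {F : Rn n → ℂ} (hF : FiberSummable F) :
    ∃ Φ : Rn n → ℂ, FiberSummable Φ ∧ ∀ ξ, samples Φ ξ = unitize (samples F ξ) := by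
  have hm : Measurable fun ξ => ((‖samples F ξ‖⁻¹ : ℝ) : ℂ) :=
    Complex.measurable_ofReal.comp hF.measurable_norm_samples.inv
  have hper : IsPeriodic fun ξ => ((‖samples F ξ‖⁻¹ : ℝ) : ℂ) := fun ξ l => by
    simp only [norm_eq_sqrt_re_inner (𝕜 := ℂ), hF.inner_samples_add_zcast hF]
  exact ⟨_, hF.mul hm hper, fun ξ => hF.samples_mul hm hper ξ⟩

theorem inner_unitaryMix_right {E : Type*} [NormedAddCommGroup E] [InnerProductSpace ℂ E]
    (U : Matrix (Fin m) (Fin m) ℂ) (x : Fin m → E) (y : E) (i : Fin m) :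
    ⟪y, unitaryMix U x i⟫_ℂ = unitaryMix U (fun j => ⟪y, x j⟫_ℂ) i := by
  simp only [unitaryMix, inner_sum, inner_smul_right, smul_eq_mul]

/-- Pointwise optimal approximation data: the mixed family `b`, with orthogonal sample sequences
whose squared norms are the eigenvalues `μ`, and normalized generators `Φ` spanning the
dominant part. -/
theorem exists_optimal_samples {F : Fin m → Rn n → ℂ} (hF : ∀ i, FiberSummable (F i)) (ℓ : ℕ) :
    ∃ (U : Rn n → Matrix (Fin m) (Fin m) ℂ) (μ : Fin m → Rn n → ℝ)
      (b : Fin m → Rn n → ℂ) (Φ : Fin ℓ → Rn n → ℂ),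
      (∀ i, Measurable (μ i)) ∧
      (∀ ξ, U ξ ∈ Matrix.unitaryGroup (Fin m) ℂ ∧ (Antitone fun i => μ i ξ) ∧
        star (U ξ) * sampleGram F ξ * U ξ = Matrix.diagonal fun i => ((μ i ξ : ℝ) : ℂ)) ∧
      (∀ i, FiberSummable (b i)) ∧
      (∀ i ξ, ‖samples (b i) ξ‖ ^ 2 = μ i ξ) ∧
      (∀ ξ i j, i ≠ j → ⟪samples (b i) ξ, samples (b j) ξ⟫_ℂ = 0) ∧
      (∀ ξ i, samples (b i) ξ = unitaryMix (U ξ) (fun j => samples (F j) ξ) i) ∧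
      (∀ j, FiberSummable (Φ j)) ∧
      (∀ ξ j, samples (Φ j) ξ = 0 ∨ ‖samples (Φ j) ξ‖ = 1) ∧
      (∀ ξ i j, i ≠ j → ⟪samples (Φ i) ξ, samples (Φ j) ξ⟫_ℂ = 0) ∧
      (∀ ξ, ∑ j, ∑ i, ‖⟪samples (F i) ξ, samples (Φ j) ξ⟫_ℂ‖ ^ 2 +
        ∑ i ∈ Finset.univ.filter (fun i : Fin m => ℓ ≤ (i : ℕ)), μ i ξ =
          ∑ i, ‖samples (F i) ξ‖ ^ 2) := by
  obtain ⟨U, μ, hUm, hUper, hμ, h⟩ := exists_periodic_diagonalization hF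
  have hcm : ∀ i j, Measurable fun ξ => (starRingEnd ℂ) (U ξ j i) := fun i j =>
    Complex.continuous_conj.measurable.comp (hUm j i)
  have hcper : ∀ i j, IsPeriodic fun ξ => (starRingEnd ℂ) (U ξ j i) := fun i j ξ l => by
    simp only [hUper j i ξ l]
  set b : Fin m → Rn n → ℂ := fun i ξ => ∑ j, (starRingEnd ℂ) (U ξ j i) * F j ξ with hb
  have hbF : ∀ i, FiberSummable (b i) := fun i => FiberSummable.sum_mul hF (hcm i) (hcper i)
  have hbs : ∀ ξ i, samples (b i) ξ = unitaryMix (U ξ) (fun j => samples (F j) ξ) i :=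
    fun ξ i => samples_sum_mul hF (hcm i) (hcper i) ξ
  have hbinner : ∀ ξ i j, ⟪samples (b j) ξ, samples (b i) ξ⟫_ℂ =
      Matrix.diagonal (fun i => ((μ i ξ : ℝ) : ℂ)) i j := fun ξ i j => by
    rw [hbs, hbs, inner_unitaryMix, ← (h ξ).2.2]
    rfl
  have hbn : ∀ i ξ, ‖samples (b i) ξ‖ ^ 2 = μ i ξ := fun i ξ => by
    have := hbinner ξ i i
    rw [Matrix.diagonal_apply_eq, inner_self_eq_norm_sq_to_K] at this
    exact Complex.ofReal_injective (by simpa using this)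
  have hbo : ∀ ξ i j, i ≠ j → ⟪samples (b i) ξ, samples (b j) ξ⟫_ℂ = 0 := fun ξ i j hij => by
    rw [hbinner, Matrix.diagonal_apply_ne _ hij.symm]
  set b' : ℕ → Rn n → ℂ := fun j => if hj : j < m then b ⟨j, hj⟩ else fun _ => 0 with hb'
  have hb'F : ∀ j, FiberSummable (b' j) := fun j => by
    by_cases hj : j < m
    · simpa only [hb', dif_pos hj] using hbF _
    · simpa only [hb', dif_neg hj] using fiberSummable_zero
  choose Φ hΦF hΦ using fun j => (hb'F j).unitize_samples
  have hb'o : ∀ ξ i j, i ≠ j → ⟪samples (b' i) ξ, samples (b' j) ξ⟫_ℂ = 0 := fun ξ i j hij => by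
    by_cases hi : i < m
    · by_cases hj : j < m
      · simp only [hb', dif_pos hi, dif_pos hj]
        exact hbo ξ _ _ fun h => hij (Fin.mk.inj_iff.mp h)
      · simp only [hb', dif_neg hj, samples_zero, inner_zero_right]
    · simp only [hb', dif_neg hi, samples_zero, inner_zero_left]
  have hsum : ∀ ξ (j : ℕ), ∑ i, ‖⟪samples (F i) ξ, samples (Φ j) ξ⟫_ℂ‖ ^ 2 =
      if hj : j < m then μ ⟨j, hj⟩ ξ else 0 := fun ξ j => by
    have h1 : ∑ i, ‖⟪samples (F i) ξ, samples (Φ j) ξ⟫_ℂ‖ ^ 2 =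
        ∑ i : Fin m, ‖⟪samples (Φ j) ξ, samples (b i) ξ⟫_ℂ‖ ^ 2 := by
      simp only [hbs, inner_unitaryMix_right]
      rw [sum_norm_sq_unitaryMix (h ξ).1]
      exact Finset.sum_congr rfl fun i _ => by rw [norm_inner_symm]
    rw [h1]
    have h2 : ∀ i : Fin m, b i = b' i := fun i => by simp [hb']
    by_cases hj : j < m
    · rw [dif_pos hj, Finset.sum_eq_single ⟨j, hj⟩]
      · rw [h2, hΦ, norm_inner_unitize_self_sq, ← hbn, h2]
      · intro i _ hij
        have h0 : ⟪samples (b' j) ξ, samples (b' i) ξ⟫_ℂ = 0 :=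
          hb'o ξ _ _ fun h => hij (Fin.ext h.symm)
        rw [h2, hΦ, unitize, inner_smul_left, h0]
        simp
      · simp
    · have h0 : samples (Φ j) ξ = 0 := by
        rw [hΦ]
        simp only [hb', dif_neg hj, samples_zero]
        simp [unitize]
      simp [h0, dif_neg hj]
  refine ⟨U, μ, b, fun j => Φ j, hμ, h, hbF, hbn, hbo, hbs, fun j => hΦF j,
    fun ξ j => ?_, fun ξ i j hij => ?_, fun ξ => ?_⟩
  · simp only [hΦ]
    exact unitize_eq_zero_or _
  · simp only [hΦ]
    exact inner_unitize_eq_zero (hb'o ξ i j fun h => hij (Fin.ext h))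
  · set ν : ℕ → ℝ := fun j => if hj : j < m then μ ⟨j, hj⟩ ξ else 0 with hν
    have h3 : ∑ i : Fin m, ‖samples (F i) ξ‖ ^ 2 = ∑ i, μ i ξ := by
      rw [← sum_norm_sq_unitaryMix (h ξ).1]
      exact Finset.sum_congr rfl fun i _ => by rw [← hbs, hbn]
    have h4 : ∑ j : Fin ℓ, ∑ i, ‖⟪samples (F i) ξ, samples (Φ j) ξ⟫_ℂ‖ ^ 2 =
        ∑ i ∈ Finset.univ.filter (fun i : Fin m => ¬ ℓ ≤ (i : ℕ)), μ i ξ := by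
      simp only [hsum]
      rw [Fin.sum_univ_eq_sum_range ν ℓ, Finset.sum_filter]
      have h5 : ∀ i : Fin m, (if ¬ ℓ ≤ (i : ℕ) then μ i ξ else 0) =
          (fun i : ℕ => if i < ℓ then ν i else 0) i := fun i => by
        simp [hν]
      simp only [h5]
      rw [Fin.sum_univ_eq_sum_range (fun i : ℕ => if i < ℓ then ν i else 0) m, ← Finset.sum_filter]
      symm
      refine Finset.sum_subset (fun i hi => ?_) fun i hi hi' => ?_
      · simp at hi ⊢
        omega
      · have : ¬ i < m := by simp at hi hi'; omega
        simp [hν, this]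
    rw [h3, h4, add_comm]
    exact Finset.sum_filter_add_sum_filter_not _ _ _

end OptimalSamples

section LowerBound

variable {m ℓ : ℕ}

/-- Eckart–Young lower bound for a family that is diagonalized by a unitary mixing. -/
theorem sum_tail_norm_sq_unitaryMix_le {E : Type*} [NormedAddCommGroup E]
    [InnerProductSpace ℂ E] {U : Matrix (Fin m) (Fin m) ℂ}
    (hU : U ∈ Matrix.unitaryGroup (Fin m) ℂ) {x w : Fin m → E}
    (ho : ∀ i j, i ≠ j → ⟪unitaryMix U x i, unitaryMix U x j⟫_ℂ = 0)
    (hanti : Antitone fun i => ‖unitaryMix U x i‖ ^ 2) (ψ : Fin ℓ → E)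
    (hw : ∀ i, w i ∈ Submodule.span ℂ (Set.range ψ)) :
    ∑ i ∈ Finset.univ.filter (fun i : Fin m => ℓ ≤ (i : ℕ)), ‖unitaryMix U x i‖ ^ 2 ≤
      ∑ i, ‖x i - w i‖ ^ 2 := by
  refine (sum_tail_norm_sq_le_of_orthogonal (w := unitaryMix U w) ho hanti ψ fun i =>
    Submodule.sum_mem _ fun j _ => Submodule.smul_mem _ _ (hw j)).trans (le_of_eq ?_)
  rw [← sum_norm_sq_unitaryMix hU fun i => x i - w i]
  refine Finset.sum_congr rfl fun i _ => ?_
  simp only [unitaryMix, smul_sub, Finset.sum_sub_distrib]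

/-- On the Fourier side, the span of the θ-translates of a family consists of combinations of
the transformed family with measurable periodic coefficients. -/
theorem IsPlancherel.exists_periodic_coefficients {𝓕 : L2 n ≃ₗᵢ[ℂ] L2 n} (h𝓕 : IsPlancherel 𝓕)
    (θ : ℝ) {ψ : Fin ℓ → L2 n} {Ψ : Fin ℓ → Rn n → ℂ}
    (hψ : ∀ j, chirpFourier 𝓕 θ (ψ j) =ᵐ[volume] Ψ j) {h : L2 n}
    (hh : h ∈ Submodule.span ℂ {h | ∃ (k : Fin n → ℤ) (j : Fin ℓ),
      h = thetaTransLp θ (zcast k) (ψ j)}) :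
    ∃ q : Fin ℓ → Rn n → ℂ, (∀ j, Measurable (q j)) ∧ (∀ j, IsPeriodic (q j)) ∧
      chirpFourier 𝓕 θ h =ᵐ[volume] fun ξ => ∑ j, q j ξ * Ψ j ξ := by
  induction hh using Submodule.span_induction with
  | mem x hx =>
    obtain ⟨k, j, rfl⟩ := hx
    obtain ⟨c, -, hc⟩ := h𝓕.exists_chirpFourier_thetaTransLp θ (zcast k)
    refine ⟨fun i ξ => if i = j then c * character (zcast k) ξ else 0, fun i => ?_,
      fun i ξ l => ?_, ?_⟩
    · by_cases hij : i = j
      · simpa only [if_pos hij] using (measurable_character _).const_mul c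
      · simp only [if_neg hij, measurable_const]
    · simp only [character_add_zcast]
    · filter_upwards [hc (ψ j), hψ j] with ξ h₁ h₂
      simp [h₁, h₂, mul_assoc]
  | zero =>
    refine ⟨fun _ _ => 0, fun _ => measurable_const, fun _ _ _ => rfl, ?_⟩
    rw [map_zero]
    filter_upwards [Lp.coeFn_zero ℂ 2 (volume : Measure (Rn n))] with ξ h₁
    rw [h₁]
    simp
  | add x y _ _ hx hy =>
    obtain ⟨q, hq, hqp, hqe⟩ := hx
    obtain ⟨r, hr, hrp, hre⟩ := hy
    refine ⟨fun j ξ => q j ξ + r j ξ, fun j => (hq j).add (hr j), fun j ξ l => ?_, ?_⟩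
    · simp only [hqp j ξ l, hrp j ξ l]
    · rw [map_add]
      filter_upwards [Lp.coeFn_add (chirpFourier 𝓕 θ x) (chirpFourier 𝓕 θ y), hqe, hre]
        with ξ h₁ h₂ h₃
      rw [h₁, Pi.add_apply, h₂, h₃]
      simp only [add_mul, Finset.sum_add_distrib]
  | smul a x _ hx =>
    obtain ⟨q, hq, hqp, hqe⟩ := hx
    refine ⟨fun j ξ => a * q j ξ, fun j => (hq j).const_mul a, fun j ξ l => ?_, ?_⟩
    · simp only [hqp j ξ l]
    · rw [map_smul]
      filter_upwards [Lp.coeFn_smul a (chirpFourier 𝓕 θ x), hqe] with ξ h₁ h₂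
      simp [h₁, h₂, mul_assoc, Finset.mul_sum]

theorem enorm_sq_eq_ofReal {E : Type*} [SeminormedAddCommGroup E] (x : E) :
    ‖x‖ₑ ^ 2 = ENNReal.ofReal (‖x‖ ^ 2) := by
  rw [← ofReal_norm, ENNReal.ofReal_pow (norm_nonneg _)]

/-- Every choice of approximants from the closed span of θ-translates of `ℓ` functions has error at
least the integral of the tail eigenvalues. -/
theorem IsPlancherel.lintegral_tail_le {𝓕 : L2 n ≃ₗᵢ[ℂ] L2 n} (h𝓕 : IsPlancherel 𝓕) (θ : ℝ)
    {f : Fin m → L2 n} {F : Fin m → Rn n → ℂ} (hF : ∀ i, FiberSummable (F i))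
    (hf : ∀ i, chirpFourier 𝓕 θ (f i) =ᵐ[volume] F i)
    {U : Rn n → Matrix (Fin m) (Fin m) ℂ} {μ : Fin m → Rn n → ℝ}
    (hU : ∀ ξ, U ξ ∈ Matrix.unitaryGroup (Fin m) ℂ) (hanti : ∀ ξ, Antitone fun i => μ i ξ)
    (hn : ∀ ξ i, ‖unitaryMix (U ξ) (fun j => samples (F j) ξ) i‖ ^ 2 = μ i ξ)
    (ho : ∀ ξ i j, i ≠ j → ⟪unitaryMix (U ξ) (fun j => samples (F j) ξ) i,
      unitaryMix (U ξ) (fun j => samples (F j) ξ) j⟫_ℂ = 0)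
    (ψ : Fin ℓ → L2 n) {w : Fin m → L2 n}
    (hw : ∀ i, w i ∈ (Submodule.span ℂ {h | ∃ (k : Fin n → ℤ) (j : Fin ℓ),
      h = thetaTransLp θ (zcast k) (ψ j)}).topologicalClosure) :
    ∫⁻ ξ in unitBox n, ∑ i ∈ Finset.univ.filter (fun i : Fin m => ℓ ≤ (i : ℕ)),
      ENNReal.ofReal (μ i ξ) ≤ ∑ i, ‖f i - w i‖ₑ ^ 2 := by
  set S := Submodule.span ℂ {h | ∃ (k : Fin n → ℤ) (j : Fin ℓ),
      h = thetaTransLp θ (zcast k) (ψ j)} with hS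
  set C := ∫⁻ ξ in unitBox n, ∑ i ∈ Finset.univ.filter (fun i : Fin m => ℓ ≤ (i : ℕ)),
      ENNReal.ofReal (μ i ξ) with hC
  have hclosed : IsClosed {w : Fin m → L2 n | C ≤ ∑ i, ‖f i - w i‖ₑ ^ 2} := by
    refine isClosed_le continuous_const (continuous_finsetSum _ fun i _ => ?_)
    exact (ENNReal.continuous_pow 2).comp
      (continuous_const.sub (continuous_apply i)).enorm
  have hsub : Set.univ.pi (fun _ : Fin m => (S : Set (L2 n))) ⊆
      {w : Fin m → L2 n | C ≤ ∑ i, ‖f i - w i‖ₑ ^ 2} := by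
    intro w hw
    choose Ψ hΨ hψ using fun j => exists_fiberSummable (chirpFourier 𝓕 θ (ψ j))
    choose q hq hqp hqe using fun i =>
      h𝓕.exists_periodic_coefficients θ hψ (hw i (Set.mem_univ i))
    have hW : ∀ i, FiberSummable fun ξ => ∑ j, q i j ξ * Ψ j ξ := fun i =>
      FiberSummable.sum_mul hΨ (hq i) (hqp i)
    have hsW : ∀ i ξ, samples (fun ξ => ∑ j, q i j ξ * Ψ j ξ) ξ =
      ∑ j, q i j ξ • samples (Ψ j) ξ := fun i => samples_sum_mul hΨ (hq i) (hqp i)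
    have hnorm : ∀ i, ‖f i - w i‖ₑ ^ 2 = ∫⁻ ξ in unitBox n,
        ‖samples (F i) ξ - ∑ j, q i j ξ • samples (Ψ j) ξ‖ₑ ^ 2 := fun i => by
      have h1 : ‖f i - w i‖ₑ = ‖chirpFourier 𝓕 θ (f i - w i)‖ₑ := by
        rw [← ofReal_norm, ← ofReal_norm, LinearIsometryEquiv.norm_map]
      have h2 : chirpFourier 𝓕 θ (f i - w i) =ᵐ[volume]
          fun ξ => F i ξ - ∑ j, q i j ξ * Ψ j ξ := by
        rw [map_sub]
        filter_upwards [Lp.coeFn_sub (chirpFourier 𝓕 θ (f i)) (chirpFourier 𝓕 θ (w i)), hf i,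
          hqe i] with ξ h₁ h₂ h₃
        rw [h₁, Pi.sub_apply, h₂, h₃]
      rw [h1, ((hF i).sub (hW i)).enorm_sq_eq h2]
      exact lintegral_congr fun ξ => by rw [(hF i).samples_sub (hW i), hsW]
    have hmeas : ∀ i, Measurable fun ξ =>
        ‖samples (F i) ξ - ∑ j, q i j ξ • samples (Ψ j) ξ‖ₑ ^ 2 := fun i => by
      have := ((hF i).sub (hW i)).measurable_norm_samples
      simp only [(hF i).samples_sub (hW i), hsW] at this
      simpa only [ofReal_norm] using this.ennreal_ofReal.pow_const 2
    simp only [Set.mem_ofPred_eq, hnorm]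
    rw [← lintegral_finsetSum _ fun i _ => hmeas i]
    refine lintegral_mono fun ξ => ?_
    simp only [enorm_sq_eq_ofReal]
    rw [← ENNReal.ofReal_sum_of_nonneg fun i _ => by rw [← hn]; positivity,
      ← ENNReal.ofReal_sum_of_nonneg fun i _ => by positivity]
    refine ENNReal.ofReal_le_ofReal ?_
    have := sum_tail_norm_sq_unitaryMix_le (hU ξ) (ho ξ) (by simpa only [hn] using hanti ξ)
      (fun j => samples (Ψ j) ξ) (w := fun i => ∑ j, q i j ξ • samples (Ψ j) ξ)
      fun i => Submodule.sum_mem _ fun j _ =>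
        Submodule.smul_mem _ _ (Submodule.subset_span ⟨j, rfl⟩)
    simpa only [hn] using this
  have hmem : w ∈ closure (Set.univ.pi (fun _ : Fin m => (S : Set (L2 n)))) := by
    rw [closure_pi_set]
    exact fun i _ => hw i
  exact hclosed.closure_subset_iff.mpr hsub hmem

end LowerBound

section Generators

variable {m ℓ : ℕ}

theorem volume_unitBox_ne_top : volume (unitBox n : Set (Rn n)) ≠ ∞ := by
  rw [measure_congr unitBox_ae_eq_fundamentalDomain]
  exact (ZSpan.fundamentalDomain_isBounded _).measure_lt_top.ne

theorem FiberSummable.memLp_of_norm_samples_le_one {F : Rn n → ℂ} (hF : FiberSummable F)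
    (h1 : ∀ ξ, ‖samples F ξ‖ ≤ 1) : MemLp F 2 volume := by
  refine hF.memLp (ne_top_of_le_ne_top (volume_unitBox_ne_top (n := n)) ?_)
  refine (lintegral_mono fun ξ => ?_).trans (setLIntegral_one _).le
  rw [enorm_sq_eq_ofReal, ENNReal.ofReal_le_one]
  exact pow_le_one₀ (norm_nonneg _) (h1 ξ)

theorem FiberSummable.measurable_enorm_inner_sq {F G : Rn n → ℂ} (hF : FiberSummable F)
    (hG : FiberSummable G) : Measurable fun ξ => ‖⟪samples F ξ, samples G ξ⟫_ℂ‖ₑ ^ 2 :=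
  (hF.measurable_inner_samples hG).enorm.pow_const 2

/-- The frame coefficients of `f` with respect to the θ-translates of `φ`, in terms of the sample
sequences of the transforms. -/
theorem IsPlancherel.tsum_enorm_inner_thetaTransLp_sq {𝓕 : L2 n ≃ₗᵢ[ℂ] L2 n}
    (h𝓕 : IsPlancherel 𝓕) (θ : ℝ) {φ : Fin ℓ → L2 n} {Φ : Fin ℓ → Rn n → ℂ}
    (hΦ : ∀ j, FiberSummable (Φ j)) (hΦ1 : ∀ j ξ, ‖samples (Φ j) ξ‖ ≤ 1)
    (hφ : ∀ j, chirpFourier 𝓕 θ (φ j) =ᵐ[volume] Φ j) {f : L2 n} {F : Rn n → ℂ}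
    (hF : FiberSummable F) (hf : chirpFourier 𝓕 θ f =ᵐ[volume] F) :
    ∑' p : (Fin n → ℤ) × Fin ℓ, ‖⟪f, thetaTransLp θ (zcast p.1) (φ p.2)⟫_ℂ‖ₑ ^ 2 =
      ∫⁻ ξ in unitBox n, ∑ j, ‖⟪samples F ξ, samples (Φ j) ξ⟫_ℂ‖ₑ ^ 2 := by
  choose c hc hcf using fun k : Fin n → ℤ => h𝓕.exists_chirpFourier_thetaTransLp θ (zcast k)
  rw [lintegral_finsetSum _ fun j _ => hF.measurable_enorm_inner_sq (hΦ j),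
    ENNReal.tsum_prod (f := fun k j => ‖⟪f, thetaTransLp θ (zcast k) (φ j)⟫_ℂ‖ₑ ^ 2),
    ENNReal.tsum_comm, tsum_fintype]
  refine Finset.sum_congr rfl fun j _ => ?_
  rw [← hF.tsum_enorm_inner_sq (hΦ j) (hΦ1 j) hf hc
    (g := fun k => chirpFourier 𝓕 θ (thetaTransLp θ (zcast k) (φ j)))]
  · exact tsum_congr fun k => by rw [LinearIsometryEquiv.inner_map_map]
  · intro k
    filter_upwards [hcf k (φ j), hφ j] with ξ h₁ h₂
    rw [h₁, h₂]

theorem LinearIsometryEquiv.enorm_map_eq {E F : Type*} [NormedAddCommGroup E]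
    [NormedSpace ℂ E] [NormedAddCommGroup F] [NormedSpace ℂ F] (e : E ≃ₗᵢ[ℂ] F) (x : E) :
    ‖e x‖ₑ = ‖x‖ₑ := by
  rw [← ofReal_norm, ← ofReal_norm, LinearIsometryEquiv.norm_map]

/-- If the sample sequences of the transformed generators are orthogonal and of norm zero or one,
the θ-translates of the generators form a Parseval frame for their closed span. -/
theorem IsPlancherel.parseval_thetaTransLp {𝓕 : L2 n ≃ₗᵢ[ℂ] L2 n}
    (h𝓕 : IsPlancherel 𝓕) (θ : ℝ) {φ : Fin ℓ → L2 n} {Φ : Fin ℓ → Rn n → ℂ}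
    (hΦ : ∀ j, FiberSummable (Φ j))
    (h01 : ∀ ξ j, samples (Φ j) ξ = 0 ∨ ‖samples (Φ j) ξ‖ = 1)
    (ho : ∀ ξ i j, i ≠ j → ⟪samples (Φ i) ξ, samples (Φ j) ξ⟫_ℂ = 0)
    (hφ : ∀ j, chirpFourier 𝓕 θ (φ j) =ᵐ[volume] Φ j) {h : L2 n}
    (hh : h ∈ (Submodule.span ℂ {h | ∃ (k : Fin n → ℤ) (j : Fin ℓ),
      h = thetaTransLp θ (zcast k) (φ j)}).topologicalClosure) :
    ∑' p : (Fin n → ℤ) × Fin ℓ, ‖⟪h, thetaTransLp θ (zcast p.1) (φ p.2)⟫_ℂ‖ₑ ^ 2 =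
      ‖h‖ₑ ^ 2 := by
  have hΦ1 : ∀ j ξ, ‖samples (Φ j) ξ‖ ≤ 1 := fun j ξ => by
    rcases h01 ξ j with h | h <;> simp [h]
  have hset : {h | ∃ (k : Fin n → ℤ) (j : Fin ℓ), h = thetaTransLp θ (zcast k) (φ j)} =
      Set.range fun p : (Fin n → ℤ) × Fin ℓ => thetaTransLp θ (zcast p.1) (φ p.2) := by
    ext x
    simp [eq_comm]
  rw [hset] at hh
  refine tsum_enorm_inner_sq_of_mem_closure_span (fun x => ?_) (fun p => ?_) hh
  · obtain ⟨F, hF, hf⟩ := exists_fiberSummable (chirpFourier 𝓕 θ x)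
    rw [h𝓕.tsum_enorm_inner_thetaTransLp_sq θ hΦ hΦ1 hφ hF hf,
      ← LinearIsometryEquiv.enorm_map_eq (chirpFourier 𝓕 θ) x, hF.enorm_sq_eq hf]
    refine lintegral_mono fun ξ => ?_
    simp only [enorm_sq_eq_ofReal]
    rw [← ENNReal.ofReal_sum_of_nonneg fun j _ => by positivity]
    refine ENNReal.ofReal_le_ofReal ?_
    simpa only [norm_inner_symm] using
      sum_norm_inner_sq_le_of_orthonormal_or_zero (h01 ξ) (ho ξ) (samples F ξ)
  · obtain ⟨k, j⟩ := p
    obtain ⟨c, hc, hcf⟩ := h𝓕.exists_chirpFourier_thetaTransLp θ (zcast k)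
    have hm : Measurable fun ξ : Rn n => c * character (zcast k) ξ :=
      (measurable_character _).const_mul c
    have hper : IsPeriodic fun ξ : Rn n => c * character (zcast k) ξ := fun ξ l => by
      simp only [character_add_zcast]
    have hf : chirpFourier 𝓕 θ (thetaTransLp θ (zcast k) (φ j)) =ᵐ[volume]
        fun ξ => c * character (zcast k) ξ * Φ j ξ := by
      filter_upwards [hcf (φ j), hφ j] with ξ h₁ h₂
      rw [h₁, h₂, mul_assoc]
    rw [h𝓕.tsum_enorm_inner_thetaTransLp_sq θ hΦ hΦ1 hφ ((hΦ j).mul hm hper) hf,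
      ← LinearIsometryEquiv.enorm_map_eq (chirpFourier 𝓕 θ),
      ((hΦ j).mul hm hper).enorm_sq_eq hf]
    refine lintegral_congr fun ξ => ?_
    rw [(hΦ j).samples_mul hm hper, Finset.sum_eq_single j]
    · simp only [enorm_sq_eq_ofReal, inner_smul_left, norm_mul, norm_smul,
        RCLike.norm_conj, hc, norm_character, inner_self_eq_norm_sq_to_K]
      rcases h01 ξ j with h | h <;> simp [h]
    · intro i _ hij
      simp [ho ξ j i hij.symm]
    · simp

theorem enorm_sq_eq_add_of_inner_sub_eq_zero {E : Type*} [NormedAddCommGroup E]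
    [InnerProductSpace ℂ E] {f p : E} (h : ⟪f - p, p⟫_ℂ = 0) :
    ‖f‖ₑ ^ 2 = ‖f - p‖ₑ ^ 2 + ‖p‖ₑ ^ 2 := by
  have := norm_add_sq_eq_norm_sq_add_norm_sq_of_inner_eq_zero _ _ h
  rw [sub_add_cancel] at this
  simp only [enorm_sq_eq_ofReal]
  rw [← ENNReal.ofReal_add (by positivity) (by positivity), sq, sq, sq, this]

/-- The error of approximation by the space generated by the optimal generators. -/
theorem IsPlancherel.sum_enorm_sub_sq_eq {𝓕 : L2 n ≃ₗᵢ[ℂ] L2 n}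
    (h𝓕 : IsPlancherel 𝓕) (θ : ℝ) {φ : Fin ℓ → L2 n} {Φ : Fin ℓ → Rn n → ℂ}
    (hΦ : ∀ j, FiberSummable (Φ j))
    (h01 : ∀ ξ j, samples (Φ j) ξ = 0 ∨ ‖samples (Φ j) ξ‖ = 1)
    (ho : ∀ ξ i j, i ≠ j → ⟪samples (Φ i) ξ, samples (Φ j) ξ⟫_ℂ = 0)
    (hφ : ∀ j, chirpFourier 𝓕 θ (φ j) =ᵐ[volume] Φ j)
    {f : Fin m → L2 n} {F : Fin m → Rn n → ℂ} (hF : ∀ i, FiberSummable (F i))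
    (hf : ∀ i, chirpFourier 𝓕 θ (f i) =ᵐ[volume] F i) {μ : Fin m → Rn n → ℝ}
    (hμ0 : ∀ i ξ, 0 ≤ μ i ξ)
    (hsum : ∀ ξ, ∑ j, ∑ i, ‖⟪samples (F i) ξ, samples (Φ j) ξ⟫_ℂ‖ ^ 2 +
        ∑ i ∈ Finset.univ.filter (fun i : Fin m => ℓ ≤ (i : ℕ)), μ i ξ =
          ∑ i, ‖samples (F i) ξ‖ ^ 2) {P : Fin m → L2 n}
    (hP : ∀ i, P i ∈ (Submodule.span ℂ {h | ∃ (k : Fin n → ℤ) (j : Fin ℓ),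
      h = thetaTransLp θ (zcast k) (φ j)}).topologicalClosure)
    (hPo : ∀ i, ∀ g ∈ (Submodule.span ℂ {h | ∃ (k : Fin n → ℤ) (j : Fin ℓ),
      h = thetaTransLp θ (zcast k) (φ j)}).topologicalClosure, ⟪f i - P i, g⟫_ℂ = 0) :
    ∑ i, ‖f i - P i‖ₑ ^ 2 = ∫⁻ ξ in unitBox n,
      ∑ i ∈ Finset.univ.filter (fun i : Fin m => ℓ ≤ (i : ℕ)), ENNReal.ofReal (μ i ξ) := by
  have hΦ1 : ∀ j ξ, ‖samples (Φ j) ξ‖ ≤ 1 := fun j ξ => by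
    rcases h01 ξ j with h | h <;> simp [h]
  have hPn : ∀ i, ‖P i‖ₑ ^ 2 =
      ∫⁻ ξ in unitBox n, ∑ j, ‖⟪samples (F i) ξ, samples (Φ j) ξ⟫_ℂ‖ₑ ^ 2 := fun i => by
    rw [← h𝓕.parseval_thetaTransLp θ hΦ h01 ho hφ (hP i),
      ← h𝓕.tsum_enorm_inner_thetaTransLp_sq θ hΦ hΦ1 hφ (hF i) (hf i)]
    refine tsum_congr fun p => ?_
    have h0 := hPo i _ (Submodule.le_topologicalClosure _
      (Submodule.subset_span ⟨p.1, p.2, rfl⟩))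
    rw [inner_sub_left, sub_eq_zero] at h0
    rw [h0]
  have hmeas : ∀ i, Measurable fun ξ => ∑ j, ‖⟪samples (F i) ξ, samples (Φ j) ξ⟫_ℂ‖ₑ ^ 2 :=
    fun i => Finset.measurable_sum _ fun j _ => (hF i).measurable_enorm_inner_sq (hΦ j)
  have hmF : ∀ i, Measurable fun ξ => ‖samples (F i) ξ‖ₑ ^ 2 := fun i => by
    simpa only [ofReal_norm] using (hF i).measurable_norm_samples.ennreal_ofReal.pow_const 2
  have h1 : ∑ i, ‖f i‖ₑ ^ 2 = ∑ i, ‖P i‖ₑ ^ 2 + ∫⁻ ξ in unitBox n,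
      ∑ i ∈ Finset.univ.filter (fun i : Fin m => ℓ ≤ (i : ℕ)), ENNReal.ofReal (μ i ξ) := by
    have h2 : ∀ i, ‖f i‖ₑ ^ 2 = ∫⁻ ξ in unitBox n, ‖samples (F i) ξ‖ₑ ^ 2 := fun i => by
      rw [← LinearIsometryEquiv.enorm_map_eq (chirpFourier 𝓕 θ), (hF i).enorm_sq_eq (hf i)]
    simp only [h2, hPn]
    rw [← lintegral_finsetSum _ fun i _ => hmF i, ← lintegral_finsetSum _ fun i _ => hmeas i,
      ← lintegral_add_left (Finset.measurable_sum _ fun i _ => hmeas i)]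
    refine lintegral_congr fun ξ => ?_
    rw [Finset.sum_comm]
    simp only [enorm_sq_eq_ofReal]
    rw [← ENNReal.ofReal_sum_of_nonneg fun i _ => by positivity, ← hsum, ENNReal.ofReal_add
      (by positivity) (Finset.sum_nonneg fun i _ => hμ0 i ξ),
      ENNReal.ofReal_sum_of_nonneg fun i _ => by positivity,
      ENNReal.ofReal_sum_of_nonneg fun i _ => hμ0 i ξ]
    congr 1
    exact Finset.sum_congr rfl fun j _ =>
      ENNReal.ofReal_sum_of_nonneg fun i _ => by positivity
  have h3 : ∑ i, ‖f i‖ₑ ^ 2 = ∑ i, ‖P i‖ₑ ^ 2 + ∑ i, ‖f i - P i‖ₑ ^ 2 := by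
    rw [← Finset.sum_add_distrib]
    exact Finset.sum_congr rfl fun i _ => by
      rw [enorm_sq_eq_add_of_inner_sub_eq_zero (hPo i _ (hP i)), add_comm]
  have hfin : ∑ i, ‖P i‖ₑ ^ 2 ≠ ∞ :=
    ENNReal.sum_ne_top.mpr fun i _ => ENNReal.pow_ne_top enorm_ne_top
  exact (ENNReal.add_right_inj hfin).mp (h3.symm.trans h1)

end Generators

section Gramian

/-- The integral over `I` of a rescaled squared norm of samples. -/
theorem FiberSummable.integral_Iθ_norm_sq {θ : ℝ} (hθ : Real.sin θ ≠ 0) {F : Rn n → ℂ}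
    (hF : FiberSummable F) :
    ∫ ω in Iθ n θ, (|Real.sin θ| ^ n)⁻¹ * ‖samples F ((Real.sin θ)⁻¹ • ω)‖ ^ 2 =
      (∫⁻ ξ in unitBox n, ‖samples F ξ‖ₑ ^ 2).toReal := by
  have hs : 0 < |Real.sin θ| ^ n := pow_pos (abs_pos.mpr hθ) n
  have hm : Measurable fun ω : Rn n => ‖samples F ((Real.sin θ)⁻¹ • ω)‖ :=
    hF.measurable_norm_samples.comp (measurable_const_smul _)
  rw [integral_eq_lintegral_of_nonneg_ae (Filter.Eventually.of_forall fun ω => by positivity)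
    ((hm.pow_const 2).const_mul _).aestronglyMeasurable]
  congr 1
  simp only [ENNReal.ofReal_mul (inv_nonneg.mpr hs.le), ← enorm_sq_eq_ofReal]
  rw [lintegral_const_mul' _ _ ENNReal.ofReal_ne_top]
  have h := lintegral_Iθ_eq hθ (hF.measurable.enorm.pow_const 2)
  simp only [enorm_sq_eq_tsum, hF.samples_apply]
  rw [h, ← mul_assoc, ← ENNReal.ofReal_mul (inv_nonneg.mpr hs.le), inv_mul_cancel₀ hs.ne',
    ENNReal.ofReal_one, one_mul, hF.lintegral_enorm_sq]
  simp only [enorm_sq_eq_tsum, hF.samples_apply]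

theorem ae_comp_smul_add {s : ℝ} (hs : s ≠ 0) {p : Rn n → Prop} (hp : ∀ᵐ x, p x) (z : Rn n) :
    ∀ᵐ ω : Rn n, p (s • ω + z) := by
  have h1 : ∀ᵐ x : Rn n, p (x + z) :=
    (measurePreserving_add_right volume z).quasiMeasurePreserving.ae hp
  have h2 : Measure.QuasiMeasurePreserving (fun ω : Rn n => s • ω) volume volume := by
    refine ⟨measurable_const_smul s, ?_⟩
    rw [Measure.map_addHaar_smul _ hs]
    exact Measure.smul_absolutelyContinuous
  exact h2.ae h1

/-- The Gramian of the fibers is almost everywhere the rescaled Gramian of the sample sequences. -/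
theorem ae_gramian_eq {θ : ℝ} (hθ : Real.sin θ ≠ 0) (𝓕 : L2 n ≃ₗᵢ[ℂ] L2 n) {m : ℕ}
    {f : Fin m → L2 n} {F : Fin m → Rn n → ℂ} (hF : ∀ i, FiberSummable (F i))
    (hf : ∀ i, chirpFourier 𝓕 θ (f i) =ᵐ[volume] F i) :
    ∀ᵐ ω : Rn n, (fun i j : Fin m => ∑' k : Fin n → ℤ,
      fiber 𝓕 θ (f i) ω k * (starRingEnd ℂ) (fiber 𝓕 θ (f j) ω k)) =
        (((|Real.sin θ| ^ n)⁻¹ : ℝ) : ℂ) • sampleGram F ((Real.sin θ)⁻¹ • ω) := by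
  have hae : ∀ᵐ ω : Rn n, ∀ (i : Fin m) (k : Fin n → ℤ),
      chirpFourier 𝓕 θ (f i) ((Real.sin θ)⁻¹ • ω + zcast k) =
        F i ((Real.sin θ)⁻¹ • ω + zcast k) :=
    ae_all_iff.mpr fun i => ae_all_iff.mpr fun k =>
      ae_comp_smul_add (inv_ne_zero hθ) (hf i) (zcast k)
  have hsq : |Real.sin θ| ^ (-(n : ℝ) / 2) * |Real.sin θ| ^ (-(n : ℝ) / 2) =
      (|Real.sin θ| ^ n)⁻¹ := by
    rw [← Real.rpow_add (abs_pos.mpr hθ), add_halves, Real.rpow_neg (abs_nonneg _),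
      Real.rpow_natCast]
  filter_upwards [hae] with ω hω
  funext i j
  rw [Matrix.smul_apply, sampleGram, Matrix.of_apply, (hF j).inner_samples (hF i), smul_eq_mul,
    ← tsum_mul_left]
  refine tsum_congr fun k => ?_
  rw [fiber, fiber, ← chirpFourier_apply, ← chirpFourier_apply, hω, hω, ← hsq, map_mul,
    Complex.conj_ofReal, Complex.ofReal_mul, RCLike.inner_apply]
  ring

end Gramian

/-- Optimal approximation of data `f₁, …, f_m ∈ L²(ℝⁿ)` by θ-shift
invariant spaces generated by at most `ℓ` elements: there exist generators `φ₁, …, φ_ℓ`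
whose θ-translates form a Parseval frame for the optimal space `V_θ`, and the error is
`Σ_{i=ℓ+1}^m ∫_I λ_i(ω) dω` where `λ₁(ω) ≥ ⋯ ≥ λ_m(ω) ≥ 0` are the measurable, decreasingly
ordered eigenvalues of the Gramian `[G^θ(ω)]_{ij} = ⟨τ^θ f_i(ω), τ^θ f_j(ω)⟩`. -/
theorem statement15 (n : ℕ) (hn : 1 ≤ n) (θ : ℝ) (hθ : Real.sin θ ≠ 0)
    (𝓕 : Lp ℂ 2 (volume : Measure (Rn n)) ≃ₗᵢ[ℂ] Lp ℂ 2 (volume : Measure (Rn n)))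
    (h𝓕 : IsPlancherel 𝓕)
    (m ℓ : ℕ) (f : Fin m → Lp ℂ 2 (volume : Measure (Rn n))) :
    ∃ φ : Fin ℓ → Lp ℂ 2 (volume : Measure (Rn n)),
      ∃ lam : Fin m → Rn n → ℝ,
        -- eigenvalues of the Gramian: measurable, a.e. decreasingly ordered, nonnegative,
        -- diagonalizing the Gramian matrix by a unitary
        (∀ i, Measurable (lam i)) ∧
        (∀ᵐ ω ∂((volume : Measure (Rn n)).restrict (Iθ n θ)),
          (∀ i j : Fin m, i ≤ j → lam j ω ≤ lam i ω) ∧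
          (∀ i : Fin m, 0 ≤ lam i ω) ∧
          ∃ U : Matrix (Fin m) (Fin m) ℂ, U ∈ Matrix.unitaryGroup (Fin m) ℂ ∧
            (fun i j : Fin m => ∑' k : Fin n → ℤ,
                fiber 𝓕 θ (f i) ω k * (starRingEnd ℂ) (fiber 𝓕 θ (f j) ω k)) =
              U * Matrix.diagonal (fun i => ((lam i ω : ℝ) : ℂ)) * star U) ∧
        ∀ Vθ : Submodule ℂ (Lp ℂ 2 (volume : Measure (Rn n))),
          Vθ = (Submodule.span ℂ
              {h | ∃ (k : Fin n → ℤ) (j : Fin ℓ),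
                h = thetaTransLp θ (zcast k) (φ j)}).topologicalClosure →
          -- (b) the θ-translates of the φ's form a Parseval frame for `V_θ`
          ((∀ h : Lp ℂ 2 (volume : Measure (Rn n)), h ∈ Vθ →
            (∑' p : (Fin n → ℤ) × Fin ℓ,
                (‖⟪h, thetaTransLp θ (zcast p.1) (φ p.2)⟫_ℂ‖₊ : ℝ≥0∞) ^ 2) =
              ENNReal.ofReal (‖h‖ ^ 2)) ∧
          -- for `Pv i` the orthogonal projection of `f i` onto `V_θ`:
          ∀ Pv : Fin m → Lp ℂ 2 (volume : Measure (Rn n)),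
            (∀ i, Pv i ∈ Vθ ∧ ∀ g ∈ Vθ, ⟪f i - Pv i, g⟫_ℂ = (0 : ℂ)) →
            -- (a) optimality among all θ-shift invariant spaces generated by ≤ ℓ elements
            ((∀ (ψ : Fin ℓ → Lp ℂ 2 (volume : Measure (Rn n)))
                (W : Submodule ℂ (Lp ℂ 2 (volume : Measure (Rn n)))),
                W = (Submodule.span ℂ
                    {h | ∃ (k : Fin n → ℤ) (j : Fin ℓ),
                      h = thetaTransLp θ (zcast k) (ψ j)}).topologicalClosure →
                ∀ Pw : Fin m → Lp ℂ 2 (volume : Measure (Rn n)),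
                  (∀ i, Pw i ∈ W ∧ ∀ g ∈ W, ⟪f i - Pw i, g⟫_ℂ = (0 : ℂ)) →
                  ∑ i, ‖f i - Pv i‖ ^ 2 ≤ ∑ i, ‖f i - Pw i‖ ^ 2) ∧
            -- (c) the approximation error
            ∑ i, ‖f i - Pv i‖ ^ 2 =
              ∑ i ∈ Finset.univ.filter (fun i : Fin m => ℓ ≤ (i : ℕ)),
                ∫ ω in Iθ n θ, lam i ω)) := by
  choose F hF hf using fun i => exists_fiberSummable (chirpFourier 𝓕 θ (f i))
  obtain ⟨U, μ, b, Φ, hμ, hU, hb, hbn, hbo, hbs, hΦ, h01, hΦo, hsum⟩ := exists_optimal_samples hF ℓ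
  have hs : 0 < |Real.sin θ| ^ n := pow_pos (abs_pos.mpr hθ) n
  have hμ0 : ∀ i ξ, 0 ≤ μ i ξ := fun i ξ => by rw [← hbn]; positivity
  have hΦL : ∀ j, MemLp (Φ j) 2 volume := fun j =>
    (hΦ j).memLp_of_norm_samples_le_one fun ξ => by rcases h01 ξ j with h | h <;> simp [h]
  set φ : Fin ℓ → L2 n := fun j => (chirpFourier 𝓕 θ).symm ((hΦL j).toLp (Φ j)) with hφdef
  have hφ : ∀ j, chirpFourier 𝓕 θ (φ j) =ᵐ[volume] Φ j := fun j => by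
    rw [hφdef, LinearIsometryEquiv.apply_symm_apply]
    exact (hΦL j).coeFn_toLp
  refine ⟨φ, fun i ω => (|Real.sin θ| ^ n)⁻¹ * μ i ((Real.sin θ)⁻¹ • ω),
    fun i => ((hμ i).comp (measurable_const_smul _)).const_mul _, ?_, ?_⟩
  · refine ae_restrict_of_ae ?_
    filter_upwards [ae_gramian_eq hθ 𝓕 hF hf] with ω hω
    set ξ := (Real.sin θ)⁻¹ • ω
    refine ⟨fun i j hij => mul_le_mul_of_nonneg_left ((hU ξ).2.1 hij) (inv_nonneg.mpr hs.le),
      fun i => mul_nonneg (inv_nonneg.mpr hs.le) (hμ0 i ξ), U ξ, (hU ξ).1, ?_⟩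
    have hd : (Matrix.diagonal fun i => (((|Real.sin θ| ^ n)⁻¹ * μ i ξ : ℝ) : ℂ)) =
        (((|Real.sin θ| ^ n)⁻¹ : ℝ) : ℂ) • (star (U ξ) * sampleGram F ξ * U ξ) := by
      rw [(hU ξ).2.2, ← Matrix.diagonal_smul]
      congr 1
      funext i
      simp
    have hUU : U ξ * star (U ξ) = 1 := Matrix.mem_unitaryGroup_iff.mp (hU ξ).1
    rw [hω, hd, Matrix.mul_smul, Matrix.smul_mul]
    congr 1
    rw [Matrix.mul_assoc, Matrix.mul_assoc, Matrix.mul_assoc, hUU, mul_one,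
      ← Matrix.mul_assoc, hUU, one_mul]
  · rintro V rfl
    refine ⟨fun h hh => ?_, fun P hP => ?_⟩
    · rw [← enorm_sq_eq_ofReal, ← h𝓕.parseval_thetaTransLp θ hΦ h01 hΦo hφ hh]
      rfl
    have herr := h𝓕.sum_enorm_sub_sq_eq θ hΦ h01 hΦo hφ hF hf hμ0 hsum (fun i => (hP i).1)
      fun i => (hP i).2
    refine ⟨?_, ?_⟩
    · rintro ψ W rfl Q hQ
      have hle := h𝓕.lintegral_tail_le θ hF hf (fun ξ => (hU ξ).1) (fun ξ => (hU ξ).2.1)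
        (fun ξ i => by rw [← hbs, hbn])
        (fun ξ i j hij => by rw [← hbs, ← hbs]; exact hbo ξ i j hij) ψ fun i => (hQ i).1
      rw [← herr] at hle
      simp only [enorm_sq_eq_ofReal] at hle
      rwa [← ENNReal.ofReal_sum_of_nonneg fun i _ => by positivity,
        ← ENNReal.ofReal_sum_of_nonneg fun i _ => by positivity,
        ENNReal.ofReal_le_ofReal_iff (by positivity)] at hle
    · have hintg : ∀ i, ∫ ω in Iθ n θ, (|Real.sin θ| ^ n)⁻¹ * μ i ((Real.sin θ)⁻¹ • ω) =
          (∫⁻ ξ in unitBox n, ENNReal.ofReal (μ i ξ)).toReal := fun i => by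
        simpa only [enorm_sq_eq_ofReal, hbn] using (hb i).integral_Iθ_norm_sq hθ
      rw [lintegral_finsetSum _ fun i _ => (hμ i).ennreal_ofReal] at herr
      have hfin : ∑ i, ‖f i - P i‖ₑ ^ 2 ≠ ∞ :=
        ENNReal.sum_ne_top.mpr fun i _ => ENNReal.pow_ne_top enorm_ne_top
      simp only [hintg]
      rw [← ENNReal.toReal_sum (ENNReal.sum_ne_top.mp (herr ▸ hfin)), ← herr]
      simp only [enorm_sq_eq_ofReal]
      rw [← ENNReal.ofReal_sum_of_nonneg fun i _ => by positivity,
        ENNReal.toReal_ofReal (by positivity)]
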